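/- Let F(U,V) = aU⁴ + bU³V + cU²V² + dUV³ + eV⁴ be a binary quartic form with integer coefficients that is irreducible over ℚ. Then the number of pairs (u,v) ∈ ℤ² with F(u,v) = 1 or F(u,v) = −1, counted up to the identification of (u,v) with (−u,−v), is at most 276. -/

import Mathlib

/-- The value of the binary quartic form `aU⁴ + bU³V + cU²V² + dUV³ + eV⁴` at a pair. -/
def quarticFormVal (a b c d e : ℤ) (p : ℤ × ℤ) : ℤ :=
  a * p.1 ^ 4 + b * p.1 ^ 3 * p.2 + c * p.1 ^ 2 * p.2 ^ 2 + d * p.1 * p.2 ^ 3 +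
    e * p.2 ^ 4

/-- Solutions of the Thue equation `F(U,V) = ±1`. -/
abbrev QuarticThueSol (a b c d e : ℤ) : Type :=
  {p : ℤ × ℤ // quarticFormVal a b c d e p = 1 ∨ quarticFormVal a b c d e p = -1}

/-- Identification of a solution `(u,v)` with `(-u,-v)`. -/
def pmRelQuartic (a b c d e : ℤ) (p q : QuarticThueSol a b c d e) : Prop :=
  (p : ℤ × ℤ) = (q : ℤ × ℤ) ∨ (p : ℤ × ℤ) = -(q : ℤ × ℤ)

namespace QuarticThue

open Polynomial

/-- `f` is a monic integral quartic with complex roots `α`, irreducible over `ℚ`. -/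
structure IsRootSystem (f : ℤ[X]) (α : Fin 4 → ℂ) : Prop where
  map_eq : f.map (Int.castRingHom ℂ) = ∏ i, (X - C (α i))
  irreducible : Irreducible (f.map (Int.castRingHom ℚ))

theorem X_sub_C_pow_dvd_iff_hasseDeriv {R : Type*} [CommRing R] (p : R[X]) (r : R) (n : ℕ) :
    (X - C r) ^ n ∣ p ↔ ∀ j < n, (hasseDeriv j p).eval r = 0 := by
  have h : (X - C r) ^ n ∣ p ↔ X ^ n ∣ taylor r p := by
    rw [← map_dvd_iff (taylorEquiv r)]
    have h1 : taylorEquiv r ((X - C r) ^ n) = X ^ n := by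
      change taylor r _ = _
      rw [taylor_pow, map_sub, taylor_X, taylor_C, add_sub_cancel_right]
    rw [h1]; rfl
  rw [h, X_pow_dvd_iff]
  simp only [taylor_coeff]

namespace IsRootSystem

variable {f : ℤ[X]} {α : Fin 4 → ℂ}

theorem monic (h : IsRootSystem f α) : f.Monic := by
  have : (f.map (Int.castRingHom ℂ)).Monic := by
    rw [h.map_eq]; exact monic_prod_of_monic _ _ fun i _ => monic_X_sub_C _
  exact monic_of_injective (Int.castRingHom ℂ).injective_int this

theorem natDegree_eq (h : IsRootSystem f α) : f.natDegree = 4 := by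
  have := congrArg natDegree h.map_eq
  rw [natDegree_map_eq_of_injective (Int.castRingHom ℂ).injective_int,
    natDegree_prod_of_monic _ _ fun i _ => monic_X_sub_C _] at this
  simpa using this

theorem aeval_root (h : IsRootSystem f α) (i : Fin 4) : aeval (α i) f = 0 := by
  have : aeval (α i) f = (f.map (Int.castRingHom ℂ)).eval (α i) := by
    rw [aeval_def, eval_map]; rfl
  rw [this, h.map_eq, eval_prod]
  exact Finset.prod_eq_zero (Finset.mem_univ i) (by simp)

theorem dvd_of_aeval_eq_zero (h : IsRootSystem f α) {g : ℤ[X]} {i : Fin 4}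
    (hg : aeval (α i) g = 0) : f ∣ g := by
  have hinteg : IsIntegral ℤ (α i) := ⟨f, h.monic, by simpa [aeval_def] using h.aeval_root i⟩
  have h1 : f.map (algebraMap ℤ ℚ) = minpoly ℚ (α i) :=
    minpoly.eq_of_irreducible_of_monic h.irreducible
      (by rw [aeval_map_algebraMap]; exact h.aeval_root i) (h.monic.map _)
  rw [minpoly.isIntegrallyClosed_eq_field_fractions' ℚ hinteg] at h1
  have h2 : f = minpoly ℤ (α i) := map_injective _ (algebraMap ℤ ℚ).injective_int h1
  rw [h2]
  exact minpoly.isIntegrallyClosed_dvd hinteg hg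

theorem aeval_eq_zero (h : IsRootSystem f α) {g : ℤ[X]} {i : Fin 4}
    (hg : aeval (α i) g = 0) (j : Fin 4) : aeval (α j) g = 0 := by
  obtain ⟨q, rfl⟩ := h.dvd_of_aeval_eq_zero hg
  simp [h.aeval_root j]

theorem exists_int_prod_aeval (h : IsRootSystem f α) (g : ℤ[X]) :
    ∃ n : ℤ, ∏ i, aeval (α i) g = n := by
  refine ⟨resultant f g f.natDegree g.natDegree, ?_⟩
  have h0 : (f.map (Int.castRingHom ℂ)).Splits := IsAlgClosed.splits _
  have h1 := resultant_eq_prod_eval (f.map (Int.castRingHom ℂ)) (g.map (Int.castRingHom ℂ))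
    g.natDegree natDegree_map_le h0
  rw [(h.monic.map _).leadingCoeff, one_pow, one_mul, resultant_map_map,
    natDegree_map_eq_of_injective (Int.castRingHom ℂ).injective_int] at h1
  have h2 : (f.map (Int.castRingHom ℂ)).roots = Finset.univ.val.map α := by
    rw [h.map_eq, ← roots_multiset_prod_X_sub_C (Finset.univ.val.map α), Multiset.map_map]
    rfl
  rw [h2] at h1
  have : ((resultant f g f.natDegree g.natDegree : ℤ) : ℂ) =
    Int.castRingHom ℂ (resultant f g f.natDegree g.natDegree) := rfl
  rw [this, h1, Multiset.map_map]
  refine Finset.prod_congr rfl fun i _ => ?_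
  simp [aeval_def, eval_map]

theorem one_le_prod_norm (h : IsRootSystem f α) {g : ℤ[X]} {i : Fin 4}
    (hg : aeval (α i) g ≠ 0) : 1 ≤ ∏ j, ‖aeval (α j) g‖ := by
  obtain ⟨n, hn⟩ := h.exists_int_prod_aeval g
  have h0 : (n : ℂ) ≠ 0 := by
    rw [← hn, Finset.prod_ne_zero_iff]
    exact fun j _ hj => hg (h.aeval_eq_zero hj i)
  rw [← norm_prod, hn, Complex.norm_intCast]
  have : n ≠ 0 := by exact_mod_cast h0
  exact_mod_cast Int.one_le_abs this

end IsRootSystem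

theorem exists_ne_forall_abs_sub_lt {ι D : Type*} [Fintype ι] [Fintype D]
    (l : ι → D → ℝ) (R c : ι → ℝ) (q : ι → ℕ) (hl : ∀ i d, |l i d| ≤ R i) (hc : ∀ i, 0 < c i)
    (hq : ∀ i, 2 * R i < c i * q i) (hcard : ∏ i, q i < Fintype.card D) :
    ∃ d d', d ≠ d' ∧ ∀ i, |l i d - l i d'| < c i := by
  classical
  have hnn : ∀ i d, 0 ≤ (l i d + R i) / c i := fun i d =>
    div_nonneg (by linarith [(abs_le.mp (hl i d)).1]) (hc i).le
  have hlt : ∀ i d, ⌊(l i d + R i) / c i⌋₊ < q i := fun i d => by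
    rw [Nat.floor_lt (hnn i d), div_lt_iff₀ (hc i)]
    linarith [(abs_le.mp (hl i d)).2, hq i]
  let φ : D → (∀ i, Fin (q i)) := fun d i => ⟨_, hlt i d⟩
  obtain ⟨d, d', hne, heq⟩ := Fintype.exists_ne_map_eq_of_card_lt φ (by simpa using hcard)
  refine ⟨d, d', hne, fun i => ?_⟩
  have h1 : ⌊(l i d + R i) / c i⌋₊ = ⌊(l i d' + R i) / c i⌋₊ :=
    congrArg Fin.val (congrFun heq i)
  have h2 := Nat.floor_le (hnn i d)
  have h3 := Nat.lt_floor_add_one ((l i d + R i) / c i)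
  have h4 := Nat.floor_le (hnn i d')
  have h5 := Nat.lt_floor_add_one ((l i d' + R i) / c i)
  rw [h1] at h2 h3
  have h6 : |(l i d + R i) / c i - (l i d' + R i) / c i| < 1 := by
    rw [abs_lt]; constructor <;> linarith
  rw [← sub_div, abs_div, abs_of_pos (hc i), div_lt_one (hc i)] at h6
  simpa using h6

theorem choose_succ_le_two_pow (k j : ℕ) : (k + 1).choose j ≤ 2 ^ k := by
  induction k generalizing j with
  | zero =>
    rcases j with _ | _ | j
    · simp
    · simp
    · rw [Nat.choose_eq_zero_of_lt (by omega)]; simp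
  | succ k ih =>
    rcases j with _ | j
    · simpa using Nat.one_le_two_pow
    · rw [Nat.choose_succ_succ, pow_succ]
      linarith [ih j, ih (j + 1)]

theorem sum_range_choose_le (k j : ℕ) : ∑ i ∈ Finset.range (k + 1), i.choose j ≤ 2 ^ k := by
  have h : ∑ i ∈ Finset.range (k + 1), i.choose j = (k + 1).choose (j + 1) := by
    induction k with
    | zero => rcases j with _ | j <;> simp [Nat.choose_eq_zero_of_lt]
    | succ k ih =>
      rw [Finset.sum_range_succ, ih, Nat.choose_succ_succ (k + 1) j]; ring
  rw [h]; exact choose_succ_le_two_pow k _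

/-- The integer polynomial `A_[j] - X B_[j]`, where `P_[j]` is the `j`-th Hasse derivative. -/
noncomputable def hasseComb (A B : ℤ[X]) (j : ℕ) : ℤ[X] := hasseDeriv j A - X * hasseDeriv j B

theorem aeval_hasseDeriv (A : ℤ[X]) (j k : ℕ) (hA : A.natDegree ≤ k) (z : ℂ) :
    aeval z (hasseDeriv j A) =
      ∑ i ∈ Finset.range (k + 1), (A.coeff i : ℂ) * (i.choose j : ℂ) * z ^ (i - j) := by
  rw [hasseDeriv_apply, sum_over_range' _ _ (k + 1) (by omega)]
  · simp [aeval_monomial, mul_comm]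
  · simp

theorem norm_aeval_hasseDeriv_le (A : ℤ[X]) (j k : ℕ) (hA : A.natDegree ≤ k) (H : ℝ)
    (hH : ∀ i, |(A.coeff i : ℝ)| ≤ H) (z : ℂ) :
    ‖aeval z (hasseDeriv j A)‖ ≤ H * 2 ^ k * max 1 ‖z‖ ^ (k - j) := by
  have hH0 : 0 ≤ H := (abs_nonneg _).trans (hH 0)
  have hz : 1 ≤ max 1 ‖z‖ := le_max_left _ _
  rw [aeval_hasseDeriv A j k hA z]
  calc ‖∑ i ∈ Finset.range (k + 1), (A.coeff i : ℂ) * (i.choose j : ℂ) * z ^ (i - j)‖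
      ≤ ∑ i ∈ Finset.range (k + 1), H * (i.choose j : ℝ) * max 1 ‖z‖ ^ (k - j) := by
        refine norm_sum_le_of_le _ fun i hi => ?_
        rw [norm_mul, norm_mul, Complex.norm_intCast, Complex.norm_natCast, norm_pow]
        have h1 : ‖z‖ ^ (i - j) ≤ max 1 ‖z‖ ^ (k - j) :=
          (pow_le_pow_left₀ (norm_nonneg z) (le_max_right _ _) _).trans
            (pow_le_pow_right₀ hz (by simp at hi; omega))
        gcongr
        exact hH i
    _ = H * ((∑ i ∈ Finset.range (k + 1), i.choose j : ℕ) : ℝ) * max 1 ‖z‖ ^ (k - j) := by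
        rw [← Finset.sum_mul, ← Finset.mul_sum]; push_cast; rfl
    _ ≤ H * 2 ^ k * max 1 ‖z‖ ^ (k - j) := by
        have := sum_range_choose_le k j
        gcongr
        exact_mod_cast this

theorem norm_aeval_hasseComb_le (A B : ℤ[X]) (j k : ℕ) (hjk : j ≤ k) (hA : A.natDegree ≤ k)
    (hB : B.natDegree ≤ k) (H : ℝ) (hAH : ∀ i, |(A.coeff i : ℝ)| ≤ H)
    (hBH : ∀ i, |(B.coeff i : ℝ)| ≤ H) (z : ℂ) :
    ‖aeval z (hasseComb A B j)‖ ≤ H * 2 ^ (k + 1) * max 1 ‖z‖ ^ (k + 1 - j) := by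
  have hH0 : 0 ≤ H := (abs_nonneg _).trans (hAH 0)
  have h1 := norm_aeval_hasseDeriv_le A j k hA H hAH z
  have h2 := norm_aeval_hasseDeriv_le B j k hB H hBH z
  have hz : 1 ≤ max 1 ‖z‖ := le_max_left _ _
  have hz' : ‖z‖ ≤ max 1 ‖z‖ := le_max_right _ _
  rw [hasseComb, map_sub, map_mul, aeval_X, Nat.succ_sub hjk, pow_succ, pow_succ]
  calc _ ≤ ‖aeval z (hasseDeriv j A)‖ + ‖z‖ * ‖aeval z (hasseDeriv j B)‖ := by
        rw [← norm_mul]; exact norm_sub_le _ _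
    _ ≤ max 1 ‖z‖ * (H * 2 ^ k * max 1 ‖z‖ ^ (k - j)) +
          max 1 ‖z‖ * (H * 2 ^ k * max 1 ‖z‖ ^ (k - j)) := by
        gcongr
        exact h1.trans (le_mul_of_one_le_left (by positivity) hz)
    _ = _ := by ring

theorem log_two_le_div_five {M : ℝ} (hM : 32 ≤ M) : 5 * Real.log 2 ≤ Real.log M := by
  have h : Real.log ((2 : ℝ) ^ 5) = 5 * Real.log 2 := by rw [Real.log_pow]; norm_num
  rw [← h]
  exact Real.log_le_log (by norm_num) (by linarith)

theorem sum_fin_sub (m k : ℕ) (hmk : m ≤ k) :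
    ∑ j : Fin m, ((k + 1 - (j : ℕ) : ℕ) : ℝ) = m * (k + 1) - m * (m - 1) / 2 := by
  rw [Fin.sum_univ_eq_sum_range (fun j => ((k + 1 - j : ℕ) : ℝ))]
  induction m with
  | zero => simp
  | succ m ih =>
    rw [Finset.sum_range_succ, ih (by omega), Nat.cast_sub (by omega)]
    push_cast; ring

theorem prod_cells_lt {M : ℝ} (hM : 32 ≤ M) {m k H : ℕ} (hm : 1 ≤ m) (hk : k = 5 * m / 2)
    (hH : M ^ (4 * m) < H + 1) :
    ∏ p : Fin m × Fin 4, (⌊(H : ℝ) * 2 ^ (k + 3) * (M ^ (1 / 4 : ℝ)) ^ (k + 1 - (p.1 : ℕ))⌋₊ + 1)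
      < ((H + 1) * (H + 1)) ^ (k + 1) := by
  have hM0 : 0 < M := by linarith
  set μ : ℝ := M ^ (1 / 4 : ℝ) with hμ
  have hμ1 : 1 ≤ μ := Real.one_le_rpow (by linarith) (by norm_num)
  have hlμ : Real.log μ = Real.log M / 4 := by rw [hμ, Real.log_rpow hM0]; ring
  have hL := log_two_le_div_five hM
  have hl2 : 0 < Real.log 2 := Real.log_pos (by norm_num)
  have hL0 : 0 < Real.log M := Real.log_pos (by linarith)
  have hlH : 4 * m * Real.log M < Real.log (H + 1) := by
    have := Real.log_lt_log (by positivity) hH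
    rw [Real.log_pow] at this; push_cast at this; exact this
  have hq : ∀ p : Fin m × Fin 4,
      Real.log ((⌊(H : ℝ) * 2 ^ (k + 3) * μ ^ (k + 1 - (p.1 : ℕ))⌋₊ + 1 : ℕ) : ℝ) ≤
        Real.log (H + 1) + (k + 3) * Real.log 2 +
          ((k + 1 - (p.1 : ℕ) : ℕ) : ℝ) * (Real.log M / 4) := by
    intro p
    have h1 : ((⌊(H : ℝ) * 2 ^ (k + 3) * μ ^ (k + 1 - (p.1 : ℕ))⌋₊ + 1 : ℕ) : ℝ) ≤
        (H + 1) * 2 ^ (k + 3) * μ ^ (k + 1 - (p.1 : ℕ)) := by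
      push_cast
      have h2 : (1 : ℝ) ≤ 2 ^ (k + 3) * μ ^ (k + 1 - (p.1 : ℕ)) :=
        one_le_mul_of_one_le_of_one_le (one_le_pow₀ (by norm_num)) (one_le_pow₀ hμ1)
      have h3 := Nat.floor_le (a := (H : ℝ) * 2 ^ (k + 3) * μ ^ (k + 1 - (p.1 : ℕ)))
        (by positivity)
      nlinarith
    refine (Real.log_le_log (by positivity) h1).trans (le_of_eq ?_)
    rw [Real.log_mul (by positivity) (by positivity), Real.log_mul (by positivity) (by positivity),
      Real.log_pow, Real.log_pow, hlμ]
    push_cast; ring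
  have hkr : (k : ℝ) ≤ 5 * m / 2 ∧ (5 * m - 1) / 2 ≤ (k : ℝ) := by
    have h1 : 2 * k ≤ 5 * m := by omega
    have h2 : 5 * m ≤ 2 * k + 1 := by omega
    have h1' : (2 : ℝ) * k ≤ 5 * m := by exact_mod_cast h1
    have h2' : (5 : ℝ) * m ≤ 2 * k + 1 := by exact_mod_cast h2
    constructor <;> linarith
  have hmr : (1 : ℝ) ≤ m := by exact_mod_cast hm
  have key : Real.log ((∏ p : Fin m × Fin 4,
      (⌊(H : ℝ) * 2 ^ (k + 3) * μ ^ (k + 1 - (p.1 : ℕ))⌋₊ + 1) : ℕ) : ℝ) <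
        Real.log ((((H + 1) * (H + 1)) ^ (k + 1) : ℕ) : ℝ) := by
    rw [Nat.cast_prod, Real.log_prod fun p _ => by positivity]
    refine (Finset.sum_le_sum fun p _ => hq p).trans_lt ?_
    rw [Fintype.sum_prod_type]
    simp only [Finset.sum_const, Finset.card_univ, Fintype.card_fin, nsmul_eq_mul]
    rw [← Finset.mul_sum, Finset.sum_add_distrib, ← Finset.sum_mul,
      sum_fin_sub m k (by omega)]
    push_cast
    rw [Real.log_pow, Real.log_mul (by positivity) (by positivity)]
    simp only [Finset.sum_const, Finset.card_univ, Fintype.card_fin, nsmul_eq_mul]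
    push_cast
    obtain ⟨hk1, hk2⟩ := hkr
    generalize Real.log (H + 1) = h at *
    generalize Real.log M = L at *
    generalize Real.log 2 = l at *
    have e1 : (k + 3) * l ≤ (5 * m / 2 + 3) * (L / 5) := by gcongr; linarith
    have e2 : (m : ℝ) * ((k + 3) * l) ≤ m * ((5 * m / 2 + 3) * (L / 5)) := by gcongr
    have e3 : (m : ℝ) * (k + 1) ≤ m * (5 * m / 2 + 1) := by gcongr
    have e4 : (m * (k + 1) - m * (m - 1) / 2) * (L / 4) ≤
        (m * (5 * m / 2 + 1) - (m : ℝ) * (m - 1) / 2) * (L / 4) := by gcongr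
    have e5 : (m + 1 : ℝ) * (4 * m * L) < (2 * k + 2 - 4 * m) * h := by
      have : (m + 1 : ℝ) ≤ 2 * k + 2 - 4 * m := by linarith
      have h0 : 0 ≤ 4 * m * L := by positivity
      calc (m + 1 : ℝ) * (4 * m * L) < (m + 1 : ℝ) * h := by gcongr
        _ ≤ _ := by
          have h1 : 0 ≤ h := by linarith
          gcongr
    have e6 : 0 ≤ m * L := by positivity
    nlinarith
  exact_mod_cast (Real.log_lt_log_iff (by positivity) (by positivity)).mp key

theorem exists_conj_root {f : ℤ[X]} {α : Fin 4 → ℂ} (h : IsRootSystem f α) (s : Fin 4) :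
    ∃ s', α s' = (starRingEnd ℂ) (α s) := by
  have h1 : aeval ((starRingEnd ℂ) (α s)) f = 0 := by
    have := congrArg (starRingEnd ℂ) (h.aeval_root s)
    rw [map_zero] at this
    rw [← this]
    exact (aeval_algHom_apply ((Complex.conjAe.toAlgHom : ℂ →ₐ[ℝ] ℂ).restrictScalars ℤ) (α s) f)
  have h2 : (∏ i, (X - C (α i))).eval ((starRingEnd ℂ) (α s)) = 0 := by
    rw [← h.map_eq, eval_map]; exact h1
  rw [eval_prod, Finset.prod_eq_zero_iff] at h2
  obtain ⟨i, -, hi⟩ := h2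
  refine ⟨i, ?_⟩
  simp only [eval_sub, eval_X, eval_C] at hi
  exact (sub_eq_zero.mp hi).symm

theorem aeval_conj (g : ℤ[X]) (z : ℂ) :
    aeval ((starRingEnd ℂ) z) g = (starRingEnd ℂ) (aeval z g) :=
  aeval_algHom_apply ((Complex.conjAe.toAlgHom : ℂ →ₐ[ℝ] ℂ).restrictScalars ℤ) z g

/-- Real or imaginary part of the value at the `s`-th root, according to the sign of the
imaginary part of the root. -/
noncomputable def realPart (α : Fin 4 → ℂ) (s : Fin 4) (z : ℂ) : ℝ :=
  if 0 ≤ (α s).im then z.re else z.im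

theorem abs_realPart_le (α : Fin 4 → ℂ) (s : Fin 4) (z : ℂ) : |realPart α s z| ≤ ‖z‖ := by
  unfold realPart; split_ifs
  · exact Complex.abs_re_le_norm z
  · exact Complex.abs_im_le_norm z

theorem realPart_sub (α : Fin 4 → ℂ) (s : Fin 4) (z w : ℂ) :
    realPart α s (z - w) = realPart α s z - realPart α s w := by
  unfold realPart; split_ifs <;> simp

theorem norm_aeval_lt_of_realPart {f : ℤ[X]} {α : Fin 4 → ℂ} (h : IsRootSystem f α) (g : ℤ[X])
    (c : ℝ → ℝ) (hg : ∀ s, |realPart α s (aeval (α s) g)| < c ‖α s‖) (s : Fin 4) :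
    ‖aeval (α s) g‖ < 2 * c ‖α s‖ := by
  obtain ⟨s', hs'⟩ := exists_conj_root h s
  have h1 := hg s
  have h2 := hg s'
  have hc : aeval (α s') g = (starRingEnd ℂ) (aeval (α s) g) := by rw [hs', aeval_conj]
  have hn : ‖α s'‖ = ‖α s‖ := by rw [hs', Complex.norm_conj]
  have him : (α s').im = -(α s).im := by rw [hs', Complex.conj_im]
  have hle := Complex.norm_le_abs_re_add_abs_im (aeval (α s) g)
  unfold realPart at h1 h2
  rw [hc, him, hn] at h2
  have h3 := (abs_nonneg _).trans_lt h1
  rcases lt_trichotomy (α s).im 0 with hneg | hzero | hpos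
  · rw [if_neg (by linarith)] at h1
    rw [if_pos (by linarith), Complex.conj_re] at h2
    linarith
  · have hre : aeval (α s) g = (starRingEnd ℂ) (aeval (α s) g) := by
      rw [← aeval_conj, Complex.conj_eq_iff_im.mpr hzero]
    rw [if_pos hzero.ge] at h1
    have := Complex.conj_eq_iff_im.mp hre.symm
    rw [this, abs_zero] at hle
    linarith
  · rw [if_pos (by linarith)] at h1
    rw [if_neg (by linarith), Complex.conj_im, abs_neg] at h2
    linarith

/-- The integer polynomial with prescribed natural number coefficients. -/
noncomputable def ofCoeffs {k H : ℕ} (v : Fin (k + 1) → Fin (H + 1)) : ℤ[X] :=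
  ∑ i : Fin (k + 1), C ((v i : ℕ) : ℤ) * X ^ (i : ℕ)

theorem coeff_ofCoeffs {k H : ℕ} (v : Fin (k + 1) → Fin (H + 1)) (n : ℕ) :
    (ofCoeffs v).coeff n = if h : n < k + 1 then ((v ⟨n, h⟩ : ℕ) : ℤ) else 0 := by
  unfold ofCoeffs
  simp only [finsetSum_coeff, coeff_C_mul, coeff_X_pow]
  split_ifs with h
  · rw [Finset.sum_eq_single (⟨n, h⟩ : Fin (k + 1))]
    · simp
    · intro b _ hb
      have : n ≠ (b : ℕ) := fun e => hb (Fin.ext e.symm)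
      simp [this]
    · simp
  · refine Finset.sum_eq_zero fun b _ => ?_
    have : n ≠ (b : ℕ) := by have := b.2; omega
    simp [this]

theorem natDegree_ofCoeffs_le {k H : ℕ} (v : Fin (k + 1) → Fin (H + 1)) :
    (ofCoeffs v).natDegree ≤ k := by
  refine natDegree_le_iff_coeff_eq_zero.mpr fun N hN => ?_
  rw [coeff_ofCoeffs, dif_neg (by omega)]

theorem coeff_ofCoeffs_mem {k H : ℕ} (v : Fin (k + 1) → Fin (H + 1)) (n : ℕ) :
    0 ≤ (ofCoeffs v).coeff n ∧ (ofCoeffs v).coeff n ≤ H := by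
  rw [coeff_ofCoeffs]
  split_ifs with h
  · have := (v ⟨n, h⟩).2
    omega
  · omega

theorem hasseComb_sub (A A' B B' : ℤ[X]) (j : ℕ) :
    hasseComb (A - A') (B - B') j = hasseComb A B j - hasseComb A' B' j := by
  simp only [hasseComb, map_sub]; ring

theorem ofCoeffs_injective {k H : ℕ} :
    Function.Injective (ofCoeffs : (Fin (k + 1) → Fin (H + 1)) → ℤ[X]) := by
  intro v w hvw
  funext i
  have h1 := congrArg (fun p => coeff p (i : ℕ)) hvw
  simp only [coeff_ofCoeffs, dif_pos i.2] at h1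
  exact Fin.ext (by exact_mod_cast h1)

theorem exists_siegel {f : ℤ[X]} {α : Fin 4 → ℂ} (h : IsRootSystem f α) {M : ℝ} (hM : 32 ≤ M)
    (hMα : ∏ i, max 1 ‖α i‖ ≤ M) {m k H : ℕ} (hm : 1 ≤ m) (hk : k = 5 * m / 2)
    (hH : M ^ (4 * m) < H + 1) :
    ∃ A B : ℤ[X], A.natDegree ≤ k ∧ B.natDegree ≤ k ∧ (A ≠ 0 ∨ B ≠ 0) ∧
      (∀ i, |(A.coeff i : ℝ)| ≤ H) ∧ (∀ i, |(B.coeff i : ℝ)| ≤ H) ∧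
      ∀ j < m, ∀ s, aeval (α s) (hasseComb A B j) = 0 := by
  have hM0 : 0 < M := by linarith
  set μ : ℝ := M ^ (1 / 4 : ℝ) with hμ
  have hμ0 : 0 < μ := Real.rpow_pos_of_pos hM0 _
  have hμ4 : μ ^ 4 = M := by
    rw [hμ, ← Real.rpow_natCast, ← Real.rpow_mul hM0.le]; norm_num
  let D := (Fin (k + 1) → Fin (H + 1)) × (Fin (k + 1) → Fin (H + 1))
  let Q : D → ℕ → ℤ[X] := fun d j => hasseComb (ofCoeffs d.1) (ofCoeffs d.2) j
  let cw : ℕ → ℝ → ℝ := fun j x => max 1 x ^ (k + 1 - j) / (2 * μ ^ (k + 1 - j))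
  obtain ⟨d, d', hne, hd⟩ := exists_ne_forall_abs_sub_lt (ι := Fin m × Fin 4) (D := D)
    (fun p d => realPart α p.2 (aeval (α p.2) (Q d p.1)))
    (fun p => H * 2 ^ (k + 1) * max 1 ‖α p.2‖ ^ (k + 1 - (p.1 : ℕ)))
    (fun p => cw p.1 ‖α p.2‖)
    (fun p => ⌊(H : ℝ) * 2 ^ (k + 3) * μ ^ (k + 1 - (p.1 : ℕ))⌋₊ + 1)
    (fun p d => by
      have hab : ∀ (v : Fin (k + 1) → Fin (H + 1)) i, |((ofCoeffs v).coeff i : ℝ)| ≤ H := by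
        intro v i
        have := coeff_ofCoeffs_mem v i
        rw [abs_of_nonneg (by exact_mod_cast this.1)]
        exact_mod_cast this.2
      exact (abs_realPart_le _ _ _).trans (norm_aeval_hasseComb_le _ _ _ k
        (by have := p.1.2; omega) (natDegree_ofCoeffs_le _) (natDegree_ofCoeffs_le _) H
        (hab _) (hab _) _))
    (fun p => by positivity)
    (fun p => by
      have h1 := Nat.lt_floor_add_one ((H : ℝ) * 2 ^ (k + 3) * μ ^ (k + 1 - (p.1 : ℕ)))
      push_cast
      have hc : 0 < cw p.1 ‖α p.2‖ := by positivity
      refine lt_of_eq_of_lt ?_ (mul_lt_mul_of_pos_left h1 hc)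
      simp only [cw]
      field_simp
      ring)
    (by
      refine (prod_cells_lt hM hm hk hH).trans_eq ?_
      simp [D, mul_pow])
  have hab : ∀ (v w : Fin (k + 1) → Fin (H + 1)) i,
      |((ofCoeffs v - ofCoeffs w).coeff i : ℝ)| ≤ H := by
    intro v w i
    have h1 := coeff_ofCoeffs_mem v i
    have h2 := coeff_ofCoeffs_mem w i
    rw [coeff_sub]
    have : |(ofCoeffs v).coeff i - (ofCoeffs w).coeff i| ≤ H := by
      rw [abs_le]; constructor <;> linarith
    exact_mod_cast this
  refine ⟨ofCoeffs d.1 - ofCoeffs d'.1, ofCoeffs d.2 - ofCoeffs d'.2,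
    (natDegree_sub_le _ _).trans (max_le (natDegree_ofCoeffs_le _) (natDegree_ofCoeffs_le _)),
    (natDegree_sub_le _ _).trans (max_le (natDegree_ofCoeffs_le _) (natDegree_ofCoeffs_le _)),
    ?_, hab _ _, hab _ _, ?_⟩
  · by_contra! hcon
    exact hne (Prod.ext (ofCoeffs_injective (sub_eq_zero.mp hcon.1))
      (ofCoeffs_injective (sub_eq_zero.mp hcon.2)))
  · intro j hj s
    by_contra hs
    set g := hasseComb (ofCoeffs d.1 - ofCoeffs d'.1) (ofCoeffs d.2 - ofCoeffs d'.2) j with hg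
    have hall : ∀ t, aeval (α t) g ≠ 0 := fun t ht => hs (h.aeval_eq_zero ht s)
    have hlt := norm_aeval_lt_of_realPart h g (cw j) (fun t => by
      have := hd (⟨j, hj⟩, t)
      rwa [← realPart_sub, ← map_sub, ← hasseComb_sub] at this)
    have h1 := h.one_le_prod_norm hs
    have h2 : ∏ t, ‖aeval (α t) g‖ < ∏ t, 2 * cw j ‖α t‖ :=
      Finset.prod_lt_prod_of_nonempty (fun t _ => norm_pos_iff.mpr (hall t))
        (fun t _ => hlt t) Finset.univ_nonempty
    have h3 : ∏ t, 2 * cw j ‖α t‖ = (∏ t, max 1 ‖α t‖) ^ (k + 1 - j) / M ^ (k + 1 - j) := by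
      have : ∀ t, 2 * cw j ‖α t‖ = max 1 ‖α t‖ ^ (k + 1 - j) / μ ^ (k + 1 - j) := by
        intro t; simp only [cw]; field_simp
      simp only [this]
      rw [Finset.prod_div_distrib, Finset.prod_pow, Finset.prod_const, Finset.card_univ,
        Fintype.card_fin, ← pow_mul, mul_comm, pow_mul, hμ4]
    have h4 : (∏ t, max 1 ‖α t‖) ^ (k + 1 - j) / M ^ (k + 1 - j) ≤ 1 := by
      rw [div_le_one (by positivity)]
      exact pow_le_pow_left₀ (by positivity) hMα _
    linarith

theorem map_hasseDeriv {R S : Type*} [Semiring R] [Semiring S] (φ : R →+* S) (p : R[X]) (j : ℕ) :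
    (hasseDeriv j p).map φ = hasseDeriv j (p.map φ) := by
  ext n; simp [hasseDeriv_coeff]

theorem map_wronskian {R S : Type*} [CommRing R] [CommRing S] (φ : R →+* S) (a b : R[X]) :
    (wronskian a b).map φ = wronskian (a.map φ) (b.map φ) := by
  simp [wronskian, derivative_map]

namespace IsRootSystem

variable {f : ℤ[X]} {α : Fin 4 → ℂ}

theorem map_rat_eq (h : IsRootSystem f α) :
    (f.map (Int.castRingHom ℚ)).map (algebraMap ℚ ℂ) = ∏ i, (X - C (α i)) := by
  rw [← h.map_eq, map_map]; congr 1

theorem rat_eq_zero_of_aeval_eq_zero (h : IsRootSystem f α) {p : ℚ[X]} {i : Fin 4}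
    (hp : aeval (α i) p = 0) (hdeg : p.natDegree < 4) : p = 0 := by
  have h1 : f.map (Int.castRingHom ℚ) = minpoly ℚ (α i) :=
    minpoly.eq_of_irreducible_of_monic h.irreducible
      (by rw [← h.aeval_root i]; exact aeval_map_algebraMap ℚ (α i) f) (h.monic.map _)
  have h2 : f.map (Int.castRingHom ℚ) ∣ p := h1 ▸ minpoly.dvd ℚ (α i) hp
  by_contra hne
  have h3 := natDegree_le_of_dvd h2 hne
  rw [natDegree_map_eq_of_injective (Int.castRingHom ℚ).injective_int, h.natDegree_eq] at h3
  omega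

theorem injective (h : IsRootSystem f α) : Function.Injective α := by
  have hs : (∏ i, (X - C (α i))).Separable := by
    rw [← h.map_rat_eq]
    exact h.irreducible.separable.map
  exact separable_prod_X_sub_C_iff.mp hs

end IsRootSystem

theorem eval_hasseDeriv_map_sub (A B : ℤ[X]) (z : ℂ) (j : ℕ) :
    (hasseDeriv j (A.map (Int.castRingHom ℂ) - C z * B.map (Int.castRingHom ℂ))).eval z =
      aeval z (hasseComb A B j) := by
  have h1 : ∀ p : ℤ[X], aeval z p = (p.map (Int.castRingHom ℂ)).eval z := by
    intro p; rw [aeval_def, eval_map]; rfl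
  have h2 : hasseDeriv j (C z * B.map (Int.castRingHom ℂ)) =
      C z * hasseDeriv j (B.map (Int.castRingHom ℂ)) := by
    rw [← smul_eq_C_mul, map_smul, smul_eq_C_mul]
  rw [h1, hasseComb, map_sub, h2, Polynomial.map_sub, Polynomial.map_mul, map_X,
    map_hasseDeriv, map_hasseDeriv]
  simp

theorem wronskian_ne_zero {f : ℤ[X]} {α : Fin 4 → ℂ} (h : IsRootSystem f α) {A B : ℤ[X]}
    {m k : ℕ} (hkm : k < 4 * m) (hA : A.natDegree ≤ k) (hB : B.natDegree ≤ k)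
    (hAB : A ≠ 0 ∨ B ≠ 0) (hv : ∀ j < m, ∀ s, aeval (α s) (hasseComb A B j) = 0) :
    wronskian A B ≠ 0 := by
  intro hW
  set a := A.map (Int.castRingHom ℚ) with ha
  set b := B.map (Int.castRingHom ℚ) with hb
  have hinj := (Int.castRingHom ℚ).injective_int
  have hab : a ≠ 0 ∨ b ≠ 0 := by
    rcases hAB with h1 | h1
    · exact Or.inl ((Polynomial.map_ne_zero_iff hinj).mpr h1)
    · exact Or.inr ((Polynomial.map_ne_zero_iff hinj).mpr h1)
  have hw : wronskian a b = 0 := by rw [ha, hb, ← map_wronskian, hW, Polynomial.map_zero]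
  obtain ⟨g, a', b', hcop, hag, hbg⟩ : ∃ g a' b' : ℚ[X], IsCoprime a' b' ∧ a = g * a' ∧
      b = g * b' := by
    obtain ⟨a', h1⟩ := EuclideanDomain.gcd_dvd_left a b
    obtain ⟨b', h2⟩ := EuclideanDomain.gcd_dvd_right a b
    have h3 := EuclideanDomain.gcd_eq_gcd_ab a b
    set g := EuclideanDomain.gcd a b
    have hg : g ≠ 0 := by
      intro hg
      rw [hg, zero_mul] at h1 h2
      rcases hab with h | h <;> contradiction
    refine ⟨g, a', b', ⟨EuclideanDomain.gcdA a b, EuclideanDomain.gcdB a b, ?_⟩, h1, h2⟩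
    refine mul_left_cancel₀ hg ?_
    rw [mul_one]
    calc _ = g * a' * EuclideanDomain.gcdA a b + g * b' * EuclideanDomain.gcdB a b := by ring
      _ = g := by rw [← h1, ← h2, ← h3]
  have hg0 : g ≠ 0 := by
    intro hg
    rw [hg, zero_mul] at hag hbg
    rcases hab with h | h <;> contradiction
  have hw' : wronskian a' b' = 0 := by
    have : g ^ 2 * wronskian a' b' = wronskian a b := by
      rw [hag, hbg]; simp only [wronskian, derivative_mul]; ring
    rw [hw] at this
    exact (mul_eq_zero.mp this).resolve_left (pow_ne_zero _ hg0)
  obtain ⟨hda, hdb⟩ := hcop.wronskian_eq_zero_iff.mp hw'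
  obtain ⟨c, rfl⟩ : ∃ c, a' = C c := ⟨_, eq_C_of_derivative_eq_zero hda⟩
  obtain ⟨d, rfl⟩ : ∃ d, b' = C d := ⟨_, eq_C_of_derivative_eq_zero hdb⟩
  have hne : ∀ s, (c : ℂ) - α s * d ≠ 0 := by
    intro s hs
    have h0 : (C c - X * C d : ℚ[X]) = 0 := by
      refine h.rat_eq_zero_of_aeval_eq_zero (i := s) (by
        rw [← hs, map_sub, map_mul, aeval_X, aeval_C, aeval_C]; rfl) ?_
      refine (natDegree_sub_le _ _).trans_lt (max_lt (by simp) ?_)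
      refine (natDegree_mul_le).trans_lt (by simp)
    have h1 := congrArg (fun p => coeff p 0) h0
    have h2 := congrArg (fun p => coeff p 1) h0
    simp [coeff_C] at h1 h2
    subst h1 h2
    exact absurd hcop (by simp [isCoprime_zero_left])
  have hdvd : ∀ s, (X - C (α s)) ^ m ∣ g.map (algebraMap ℚ ℂ) := by
    intro s
    have h1 : (X - C (α s)) ^ m ∣
        A.map (Int.castRingHom ℂ) - C (α s) * B.map (Int.castRingHom ℂ) := by
      rw [X_sub_C_pow_dvd_iff_hasseDeriv]
      intro j hj
      rw [eval_hasseDeriv_map_sub]; exact hv j hj s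
    have h2 : A.map (Int.castRingHom ℂ) - C (α s) * B.map (Int.castRingHom ℂ) =
        C ((c : ℂ) - α s * d) * g.map (algebraMap ℚ ℂ) := by
      have e1 : A.map (Int.castRingHom ℂ) = a.map (algebraMap ℚ ℂ) := by
        rw [ha, map_map]; congr 1
      have e2 : B.map (Int.castRingHom ℂ) = b.map (algebraMap ℚ ℂ) := by
        rw [hb, map_map]; congr 1
      rw [e1, e2, hag, hbg]
      simp only [Polynomial.map_mul, map_C, eq_ratCast, C_sub, C_mul]
      ring
    rw [h2] at h1
    exact (IsUnit.dvd_mul_left (isUnit_C.mpr (isUnit_iff_ne_zero.mpr (hne s)))).mp h1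
  have hdvd' : ∏ s, (X - C (α s)) ^ m ∣ g.map (algebraMap ℚ ℂ) :=
    Fintype.prod_dvd_of_coprime
      (fun i j hij => ((pairwise_coprime_X_sub_C h.injective hij).pow)) hdvd
  have hgm : g.map (algebraMap ℚ ℂ) ≠ 0 :=
    (Polynomial.map_ne_zero_iff (algebraMap ℚ ℂ).injective).mpr hg0
  have h4 := natDegree_le_of_dvd hdvd' hgm
  rw [Finset.prod_pow, natDegree_pow, natDegree_prod_of_monic _ _ fun i _ => monic_X_sub_C _,
    natDegree_map] at h4
  simp at h4
  have h5 : g.natDegree ≤ k := by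
    rcases hab with h1 | h1
    · calc g.natDegree ≤ a.natDegree := natDegree_le_of_dvd ⟨_, hag⟩ h1
        _ ≤ A.natDegree := natDegree_map_le
        _ ≤ k := hA
    · calc g.natDegree ≤ b.natDegree := natDegree_le_of_dvd ⟨_, hbg⟩ h1
        _ ≤ B.natDegree := natDegree_map_le
        _ ≤ k := hB
  omega

theorem natAbs_coeff_mul_derivative_le {A B : ℤ[X]} {k H : ℕ}
    (hB : B.natDegree ≤ k) (hAH : ∀ i, |(A.coeff i : ℝ)| ≤ H) (hBH : ∀ i, |(B.coeff i : ℝ)| ≤ H)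
    (n : ℕ) : |((A * derivative B).coeff n : ℝ)| ≤ (n + 1) * (k * H ^ 2) := by
  rw [coeff_mul]
  push_cast
  refine (Finset.abs_sum_le_sum_abs _ _).trans ?_
  have : ∀ p ∈ Finset.HasAntidiagonal.antidiagonal n,
      |(A.coeff p.1 : ℝ) * ((derivative B).coeff p.2 : ℝ)| ≤ k * H ^ 2 := by
    intro p _
    rw [abs_mul, coeff_derivative]
    by_cases hp : p.2 + 1 ≤ k
    · push_cast
      rw [abs_mul, abs_of_nonneg (show (0 : ℝ) ≤ p.2 + 1 by positivity)]
      have h1 : ((p.2 : ℝ) + 1) ≤ k := by exact_mod_cast hp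
      calc _ ≤ (H : ℝ) * (H * k) := by gcongr <;> first | exact hAH _ | exact hBH _
        _ = _ := by ring
    · have h0 : B.coeff (p.2 + 1) = 0 := coeff_eq_zero_of_natDegree_lt (by omega)
      rw [h0]
      simp; positivity
  refine (Finset.sum_le_card_nsmul _ _ _ this).trans (le_of_eq ?_)
  rw [Finset.Nat.card_antidiagonal, nsmul_eq_mul]; push_cast; ring

theorem abs_coeff_wronskian_le {A B : ℤ[X]} {k H : ℕ} (hA : A.natDegree ≤ k)
    (hB : B.natDegree ≤ k) (hAH : ∀ i, |(A.coeff i : ℝ)| ≤ H) (hBH : ∀ i, |(B.coeff i : ℝ)| ≤ H)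
    (n : ℕ) : |((wronskian A B).coeff n : ℝ)| ≤ 4 * (k + 1) ^ 2 * H ^ 2 := by
  by_cases hn : n ≤ 2 * k
  · have h1 := natAbs_coeff_mul_derivative_le hB hAH hBH n
    have h2 := natAbs_coeff_mul_derivative_le hA hBH hAH n
    have h3 : (wronskian A B).coeff n = (A * derivative B).coeff n - (B * derivative A).coeff n := by
      rw [wronskian, coeff_sub, mul_comm (derivative A)]
    have hn' : (n : ℝ) ≤ 2 * k := by exact_mod_cast hn
    rw [h3]; push_cast
    refine (abs_sub _ _).trans ((add_le_add h1 h2).trans ?_)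
    have : (n + 1 : ℝ) * (k * H ^ 2) ≤ (2 * k + 1) * (k * H ^ 2) := by gcongr
    have h0 : (0 : ℝ) ≤ H ^ 2 := by positivity
    nlinarith [mul_nonneg (Nat.cast_nonneg (α := ℝ) k) h0]
  · have hd : (wronskian A B).natDegree ≤ 2 * k := by
      refine (natDegree_sub_le _ _).trans (max_le ?_ ?_)
      · refine natDegree_mul_le.trans ?_
        have := natDegree_derivative_le B; omega
      · refine natDegree_mul_le.trans ?_
        have := natDegree_derivative_le A; omega
    rw [coeff_eq_zero_of_natDegree_lt (by omega)]
    simp; positivity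

/-- Roth's index argument in one variable: if `A - ξ₂ B` vanishes to order `j` at `ξ₁ = x₁ / y₁`
then a power of `y₁` divides the leading coefficient of the Wronskian of `A` and `B`. -/
theorem pow_le_of_vanishing {A B : ℤ[X]} {k H : ℕ} (hA : A.natDegree ≤ k)
    (hB : B.natDegree ≤ k) (hAH : ∀ i, |(A.coeff i : ℝ)| ≤ H) (hBH : ∀ i, |(B.coeff i : ℝ)| ≤ H)
    (hW : wronskian A B ≠ 0) {x₁ y₁ : ℤ} (hy : 0 < y₁) (hco : IsCoprime x₁ y₁) (ξ : ℚ) (t : ℕ)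
    (hv : ∀ j ≤ t, (hasseDeriv j (A.map (Int.castRingHom ℚ) -
      C ξ * B.map (Int.castRingHom ℚ))).eval (x₁ / y₁ : ℚ) = 0) :
    (y₁ : ℝ) ^ t ≤ 4 * (k + 1) ^ 2 * H ^ 2 := by
  set a := A.map (Int.castRingHom ℚ) with ha
  set b := B.map (Int.castRingHom ℚ) with hb
  have hyq : (y₁ : ℚ) ≠ 0 := by exact_mod_cast hy.ne'
  have h1 : (X - C (x₁ / y₁ : ℚ)) ^ (t + 1) ∣ a - C ξ * b := by
    rw [X_sub_C_pow_dvd_iff_hasseDeriv]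
    exact fun j hj => hv j (by omega)
  have h2 : (X - C (x₁ / y₁ : ℚ)) ^ t ∣ derivative (a - C ξ * b) := by
    obtain ⟨q, hq⟩ := h1
    rw [hq, derivative_mul, derivative_pow]
    refine dvd_add ?_ ?_
    · exact Dvd.dvd.mul_right (Dvd.dvd.mul_right (Dvd.dvd.mul_left (by simp) _) _) _
    · exact Dvd.dvd.mul_right (pow_dvd_pow _ (by omega)) _
  have h3 : (X - C (x₁ / y₁ : ℚ)) ^ t ∣ wronskian a b := by
    have : wronskian a b = (a - C ξ * b) * derivative b - derivative (a - C ξ * b) * b := by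
      simp only [wronskian, derivative_sub, derivative_mul, derivative_C]; ring
    rw [this]
    exact dvd_sub (Dvd.dvd.mul_right ((pow_dvd_pow _ (by omega)).trans h1) _)
      (Dvd.dvd.mul_right h2 _)
  set p : ℤ[X] := C y₁ * X + C (-x₁) with hp
  have hprim : p.IsPrimitive := by
    intro r hr
    rw [C_dvd_iff_dvd_coeff] at hr
    have e0 := hr 0
    have e1 := hr 1
    simp only [hp, coeff_add, coeff_C_mul, coeff_X_zero, mul_zero, coeff_C_zero, zero_add, dvd_neg,
      coeff_X_one, mul_one, coeff_C_succ, add_zero] at e0 e1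
    obtain ⟨u, v, huv⟩ := hco
    exact isUnit_of_dvd_one (huv ▸ dvd_add (e0.mul_left u) (e1.mul_left v))
  have hprimt : (p ^ t).IsPrimitive := by
    clear_value p
    clear hv h1 h2 h3
    induction t with
    | zero => simp
    | succ t ih => rw [pow_succ]; exact ih.mul hprim
  have h4 : p ^ t ∣ wronskian A B := by
    rw [IsPrimitive.Int.dvd_iff_map_cast_dvd_map_cast _ _ hprimt, map_wronskian]
    have : (p ^ t).map (Int.castRingHom ℚ) = C ((y₁ : ℚ) ^ t) * (X - C (x₁ / y₁ : ℚ)) ^ t := by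
      rw [Polynomial.map_pow, hp, C_pow, ← mul_pow]
      congr 1
      simp only [Polynomial.map_add, Polynomial.map_mul, map_C, map_X, mul_sub, ← C_mul]
      rw [mul_div_cancel₀ _ hyq]
      simp [sub_eq_add_neg]
    rw [this]
    exact ((isUnit_C.mpr (isUnit_iff_ne_zero.mpr (pow_ne_zero t hyq))).mul_left_dvd).mpr h3
  obtain ⟨q, hq⟩ := h4
  have hq0 : q ≠ 0 := by rintro rfl; simp [hq] at hW
  have hlp : p.leadingCoeff = y₁ := by
    rw [hp]; exact leadingCoeff_linear hy.ne'
  have h5 := congrArg leadingCoeff hq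
  rw [leadingCoeff_mul, leadingCoeff_pow, hlp] at h5
  have h6 := abs_coeff_wronskian_le hA hB hAH hBH (wronskian A B).natDegree
  change |((wronskian A B).leadingCoeff : ℝ)| ≤ _ at h6
  rw [h5] at h6
  push_cast at h6
  rw [abs_mul, abs_pow] at h6
  have h7 : (1 : ℝ) ≤ |(q.leadingCoeff : ℝ)| := by
    exact_mod_cast Int.one_le_abs (leadingCoeff_ne_zero.mpr hq0)
  have h8 : (y₁ : ℝ) ≤ |(y₁ : ℝ)| := le_abs_self _
  have h9 : (0 : ℝ) < y₁ := by exact_mod_cast hy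
  calc (y₁ : ℝ) ^ t ≤ |(y₁ : ℝ)| ^ t := by gcongr
    _ ≤ |(y₁ : ℝ)| ^ t * |(q.leadingCoeff : ℝ)| := le_mul_of_one_le_right (by positivity) h7
    _ ≤ _ := h6

theorem norm_eval_hasseDeriv_sub_le {A B : ℤ[X]} {k m j : ℕ} {H : ℝ} (hA : A.natDegree ≤ k)
    (hB : B.natDegree ≤ k) (hAH : ∀ i, |(A.coeff i : ℝ)| ≤ H) (hBH : ∀ i, |(B.coeff i : ℝ)| ≤ H)
    {a z : ℂ} (hv : ∀ i < m, aeval a (hasseComb A B i) = 0) (hjm : j < m) (hmk : m ≤ k)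
    (hz : ‖z - a‖ ≤ 1) :
    ‖(hasseDeriv j (A.map (Int.castRingHom ℂ) - C a * B.map (Int.castRingHom ℂ))).eval z‖ ≤
      H * 2 ^ (2 * k + 1) * max 1 ‖a‖ ^ (k + 1 - m) * ‖z - a‖ ^ (m - j) := by
  have hH0 : 0 ≤ H := (abs_nonneg _).trans (hAH 0)
  set P := A.map (Int.castRingHom ℂ) - C a * B.map (Int.castRingHom ℂ) with hP
  have hPdeg : P.natDegree ≤ k := by
    refine (natDegree_sub_le _ _).trans (max_le (natDegree_map_le.trans hA) ?_)
    exact natDegree_C_mul_le _ _ |>.trans (natDegree_map_le.trans hB)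
  have ha1 : 1 ≤ max 1 ‖a‖ := le_max_left _ _
  have h1 : (hasseDeriv j P).eval z = ∑ n ∈ Finset.range (k - j + 1),
      ((n + j).choose j : ℂ) * aeval a (hasseComb A B (n + j)) * (z - a) ^ n := by
    have h2 : (hasseDeriv j P).eval z = (taylor a (hasseDeriv j P)).eval (z - a) := by
      rw [taylor_eval, sub_add_cancel]
    have h3 : (taylor a (hasseDeriv j P)).natDegree < k - j + 1 := by
      rw [natDegree_taylor]
      have := natDegree_hasseDeriv_le P j
      omega
    rw [h2, eval_eq_sum_range' h3]
    refine Finset.sum_congr rfl fun n _ => ?_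
    have h4 : hasseDeriv n (hasseDeriv j P) = (n + j).choose n • hasseDeriv (n + j) P := by
      rw [← LinearMap.comp_apply, hasseDeriv_comp]; rfl
    rw [taylor_coeff, h4, eval_smul, eval_hasseDeriv_map_sub, nsmul_eq_mul, Nat.choose_symm_add]
  rw [h1]
  have h5 : ∀ n ∈ Finset.range (k - j + 1),
      ‖((n + j).choose j : ℂ) * aeval a (hasseComb A B (n + j)) * (z - a) ^ n‖ ≤
      ((n + j).choose j : ℝ) * (H * 2 ^ (k + 1) * max 1 ‖a‖ ^ (k + 1 - m) * ‖z - a‖ ^ (m - j)) := by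
    intro n hn
    simp only [Finset.mem_range] at hn
    rw [norm_mul, norm_mul, norm_pow, Complex.norm_natCast]
    by_cases hnm : n + j < m
    · rw [hv _ hnm]; simp; positivity
    · have h6 := norm_aeval_hasseComb_le A B (n + j) k (by omega) hA hB H hAH hBH a
      rw [mul_assoc]
      have h7 : max 1 ‖a‖ ^ (k + 1 - (n + j)) ≤ max 1 ‖a‖ ^ (k + 1 - m) :=
        pow_le_pow_right₀ ha1 (by omega)
      have h8 : ‖z - a‖ ^ n ≤ ‖z - a‖ ^ (m - j) :=
        pow_le_pow_of_le_one (norm_nonneg _) hz (by omega)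
      gcongr
      exact h6.trans (by gcongr)
  refine (norm_sum_le_of_le _ h5).trans ?_
  rw [← Finset.sum_mul]
  have h9 : ∑ n ∈ Finset.range (k - j + 1), ((n + j).choose j : ℝ) ≤ 2 ^ k := by
    have h10 : ∑ n ∈ Finset.range (k - j + 1), (n + j).choose j =
        ∑ i ∈ Finset.Ico j (k + 1), i.choose j := by
      rw [Finset.sum_Ico_eq_sum_range, show k + 1 - j = k - j + 1 by omega]
      exact Finset.sum_congr rfl fun n _ => by rw [add_comm]
    have h11 : ∑ i ∈ Finset.Ico j (k + 1), i.choose j ≤ 2 ^ k :=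
      (Finset.sum_le_sum_of_subset (fun i hi => by simp at hi ⊢; omega)).trans
        (sum_range_choose_le k j)
    rw [← h10] at h11
    exact_mod_cast h11
  calc _ ≤ 2 ^ k * (H * 2 ^ (k + 1) * max 1 ‖a‖ ^ (k + 1 - m) * ‖z - a‖ ^ (m - j)) := by gcongr
    _ = _ := by ring

theorem exists_int_pow_mul_eval (p : ℤ[X]) {n : ℕ} (hp : p.natDegree ≤ n) {x y : ℤ} (hy : y ≠ 0) :
    ∃ N : ℤ, (y : ℚ) ^ n * (p.map (Int.castRingHom ℚ)).eval (x / y : ℚ) = N := by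
  refine ⟨∑ i ∈ Finset.range (n + 1), p.coeff i * x ^ i * y ^ (n - i), ?_⟩
  have hyq : (y : ℚ) ≠ 0 := by exact_mod_cast hy
  rw [eval_eq_sum_range' (n := n + 1) (natDegree_map_le.trans_lt (by omega)), Finset.mul_sum]
  push_cast
  refine Finset.sum_congr rfl fun i hi => ?_
  simp only [Finset.mem_range] at hi
  have : (y : ℚ) ^ n = y ^ (n - i) * y ^ i := by rw [← pow_add]; congr 1; omega
  rw [this, div_pow, coeff_map]
  simp; field_simp

/-- Liouville type lower bound. -/
theorem one_le_pow_mul_norm {A B : ℤ[X]} {k j : ℕ} (hA : A.natDegree ≤ k)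
    (hB : B.natDegree ≤ k) {x₁ y₁ x₂ y₂ : ℤ} (hy₁ : 0 < y₁) (hy₂ : 0 < y₂)
    (hne : (hasseDeriv j (A.map (Int.castRingHom ℚ) -
      C (x₂ / y₂ : ℚ) * B.map (Int.castRingHom ℚ))).eval (x₁ / y₁ : ℚ) ≠ 0) :
    1 ≤ (y₁ : ℝ) ^ (k - j) * y₂ *
      ‖(hasseDeriv j (A.map (Int.castRingHom ℂ) -
        C (x₂ / y₂ : ℂ) * B.map (Int.castRingHom ℂ))).eval (x₁ / y₁ : ℂ)‖ := by
  have hyq : (y₂ : ℚ) ≠ 0 := by exact_mod_cast hy₂.ne'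
  have hyq1 : (y₁ : ℚ) ≠ 0 := by exact_mod_cast hy₁.ne'
  obtain ⟨N₁, hN₁⟩ := exists_int_pow_mul_eval (hasseDeriv j A) (n := k - j) (x := x₁)
    ((natDegree_hasseDeriv_le A j).trans (by omega)) hy₁.ne'
  obtain ⟨N₂, hN₂⟩ := exists_int_pow_mul_eval (hasseDeriv j B) (n := k - j) (x := x₁)
    ((natDegree_hasseDeriv_le B j).trans (by omega)) hy₁.ne'
  set δ := (hasseDeriv j (A.map (Int.castRingHom ℚ) -
      C (x₂ / y₂ : ℚ) * B.map (Int.castRingHom ℚ))).eval (x₁ / y₁ : ℚ) with hδ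
  have h1 : (y₁ : ℚ) ^ (k - j) * y₂ * δ = ((y₂ * N₁ - x₂ * N₂ : ℤ) : ℚ) := by
    have : δ = ((hasseDeriv j A).map (Int.castRingHom ℚ)).eval (x₁ / y₁ : ℚ) -
        x₂ / y₂ * ((hasseDeriv j B).map (Int.castRingHom ℚ)).eval (x₁ / y₁ : ℚ) := by
      rw [hδ, map_sub, ← smul_eq_C_mul, map_smul, map_hasseDeriv, map_hasseDeriv]
      simp
    rw [this]
    push_cast
    rw [← hN₁, ← hN₂]
    field_simp
  have h2 : (hasseDeriv j (A.map (Int.castRingHom ℂ) -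
        C (x₂ / y₂ : ℂ) * B.map (Int.castRingHom ℂ))).eval (x₁ / y₁ : ℂ) = (δ : ℂ) := by
    have e1 : A.map (Int.castRingHom ℂ) = (A.map (Int.castRingHom ℚ)).map (algebraMap ℚ ℂ) := by
      rw [map_map]; congr 1
    have e2 : B.map (Int.castRingHom ℂ) = (B.map (Int.castRingHom ℚ)).map (algebraMap ℚ ℂ) := by
      rw [map_map]; congr 1
    have e3 : C (x₂ / y₂ : ℂ) = (C (x₂ / y₂ : ℚ)).map (algebraMap ℚ ℂ) := by simp
    have e4 : (x₁ / y₁ : ℂ) = algebraMap ℚ ℂ (x₁ / y₁ : ℚ) := by simp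
    rw [e1, e2, e3, ← Polynomial.map_mul, ← Polynomial.map_sub, ← map_hasseDeriv, e4,
      eval_map_algebraMap, aeval_algebraMap_apply]
    simp [hδ]
  have h3 : (y₂ * N₁ - x₂ * N₂ : ℤ) ≠ 0 := by
    intro h0
    rw [h0] at h1
    simp [hyq, hyq1] at h1
    exact hne h1
  have h4 : ((y₁ : ℂ) ^ (k - j) * y₂ * δ) = ((y₂ * N₁ - x₂ * N₂ : ℤ) : ℂ) := by
    exact_mod_cast congrArg (fun q : ℚ => (q : ℂ)) h1
  rw [h2]
  have h5 := congrArg norm h4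
  rw [Complex.norm_intCast, norm_mul, norm_mul, norm_pow, Complex.norm_intCast,
    Complex.norm_intCast, abs_of_pos (by exact_mod_cast hy₁), abs_of_pos (by exact_mod_cast hy₂)] at h5
  rw [h5]
  exact_mod_cast Int.one_le_abs h3

theorem exp_first_term {l₁ l₂ L t : ℝ} {m k j : ℕ} (hL : 0 < L) (ht : 5 * t ≤ L) (hm : 9 ≤ m)
    (hk : k = 5 * m / 2) (hjm : j < m) (hl1 : 210 * L ≤ l₁) (hup : l₂ ≤ m * l₁)
    (hj : (j : ℝ) * l₁ ≤ l₁ + 8 * m * L + (2 * m + 2) * t) :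
    ((k - j : ℕ) : ℝ) * l₁ + l₂ + (4 * m * L + (2 * k + 1 : ℕ) * t + (k + 1 - m : ℕ) * L +
      (m - j : ℕ) * (2 * L - 4 * l₁)) < - t := by
  have hk2 : (2 : ℝ) * k ≤ 5 * m := by exact_mod_cast (by omega : 2 * k ≤ 5 * m)
  have hm' : (9 : ℝ) ≤ m := by exact_mod_cast hm
  have hj0 : (0 : ℝ) ≤ j := by positivity
  rw [Nat.cast_sub (by omega : j ≤ k), Nat.cast_sub (by omega : m ≤ k + 1),
    Nat.cast_sub hjm.le]
  push_cast
  have e1 : (k : ℝ) * l₁ ≤ 5 / 2 * m * l₁ := by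
    have : 0 ≤ (5 * m - 2 * k : ℝ) * l₁ := mul_nonneg (by linarith) (by linarith)
    linarith
  have e2 : (k : ℝ) * L ≤ 5 / 2 * m * L := by
    have : 0 ≤ (5 * m - 2 * k : ℝ) * L := mul_nonneg (by linarith) (by linarith)
    linarith
  have e3 : (k + 1 : ℝ) * (5 * t) ≤ (5 / 2 * m + 1) * L := by
    calc (k + 1 : ℝ) * (5 * t) ≤ (k + 1) * L := by gcongr
      _ ≤ _ := by linarith
  have e4 : (m + 1 : ℝ) * (5 * t) ≤ (m + 1) * L := by gcongr
  have e5 : 0 ≤ (m - 9 : ℝ) * (l₁ - 210 * L) := mul_nonneg (by linarith) (by linarith)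
  have e6 : 0 ≤ (m - 9 : ℝ) * L := mul_nonneg (by linarith) (by linarith)
  have e7 : 0 ≤ (j : ℝ) * L := by positivity
  nlinarith

theorem exp_second_term {l₁ l₂ L t : ℝ} {m k j : ℕ} (hL : 0 < L) (ht : 5 * t ≤ L) (hm : 9 ≤ m)
    (hk : k = 5 * m / 2) (hjm : j < m) (hl1 : 210 * L ≤ l₁) (hlow : (m - 1) * l₁ ≤ l₂) :
    ((k - j : ℕ) : ℝ) * l₁ + l₂ + ((2 * L - 4 * l₂) + (4 * m * L + k * t + k * (t + L))) < - t := by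
  have hk2 : (2 : ℝ) * k ≤ 5 * m := by exact_mod_cast (by omega : 2 * k ≤ 5 * m)
  have hm' : (9 : ℝ) ≤ m := by exact_mod_cast hm
  have hj0 : (0 : ℝ) ≤ j := by positivity
  rw [Nat.cast_sub (by omega : j ≤ k)]
  have e1 : (k : ℝ) * l₁ ≤ 5 / 2 * m * l₁ := by
    have : 0 ≤ (5 * m - 2 * k : ℝ) * l₁ := mul_nonneg (by linarith) (by linarith)
    linarith
  have e2 : (k : ℝ) * L ≤ 5 / 2 * m * L := by
    have : 0 ≤ (5 * m - 2 * k : ℝ) * L := mul_nonneg (by linarith) (by linarith)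
    linarith
  have e3 : (k : ℝ) * (5 * t) ≤ (5 / 2 * m) * L := by
    calc (k : ℝ) * (5 * t) ≤ k * L := by gcongr
      _ ≤ _ := by linarith
  have e5 : 0 ≤ (m - 9 : ℝ) * (l₁ - 210 * L) := mul_nonneg (by linarith) (by linarith)
  have e6 : 0 ≤ (m - 9 : ℝ) * L := mul_nonneg (by linarith) (by linarith)
  have e7 : 0 ≤ (j : ℝ) * l₁ := mul_nonneg hj0 (by linarith)
  nlinarith

/-- Two very good approximations to the same root with widely different denominators
contradict the Thue-Siegel principle. -/
theorem thue_pair {f : ℤ[X]} {α : Fin 4 → ℂ} (h : IsRootSystem f α) {M : ℝ} (hM : 32 ≤ M)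
    (hMα : ∏ i, max 1 ‖α i‖ ≤ M) (s : Fin 4) {x₁ y₁ x₂ y₂ : ℤ} (hco : IsCoprime x₁ y₁)
    (hy₁ : 0 < y₁) (hy₂ : 0 < y₂)
    (h₁ : ‖(x₁ : ℂ) - α s * y₁‖ ≤ M ^ 2 / y₁ ^ 3) (h₂ : ‖(x₂ : ℂ) - α s * y₂‖ ≤ M ^ 2 / y₂ ^ 3)
    (hl1 : 210 * Real.log M ≤ Real.log y₁) (hl2 : 8 * Real.log y₁ < Real.log y₂) : False := by
  have hM0 : 0 < M := by linarith
  have hy1r : (0 : ℝ) < y₁ := by exact_mod_cast hy₁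
  have hy2r : (0 : ℝ) < y₂ := by exact_mod_cast hy₂
  have ht := log_two_le_div_five hM
  have ht0 : 0 < Real.log 2 := Real.log_pos (by norm_num)
  have eM : M = Real.exp (Real.log M) := (Real.exp_log hM0).symm
  have e2 : (2 : ℝ) = Real.exp (Real.log 2) := (Real.exp_log (by norm_num)).symm
  have ey1 : (y₁ : ℝ) = Real.exp (Real.log y₁) := (Real.exp_log hy1r).symm
  have ey2 : (y₂ : ℝ) = Real.exp (Real.log y₂) := (Real.exp_log hy2r).symm
  set L := Real.log M with hL
  set t := Real.log 2 with htdef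
  set l₁ := Real.log y₁ with hl₁
  set l₂ := Real.log y₂ with hl₂
  have hLpos : 0 < L := by linarith
  have hl1pos : 0 < l₁ := by linarith
  set m := ⌈l₂ / l₁⌉₊ with hm
  have hup : l₂ ≤ m * l₁ := by
    have := Nat.le_ceil (l₂ / l₁)
    rwa [div_le_iff₀ hl1pos] at this
  have hm9 : 9 ≤ m := by
    have : (8 : ℝ) < m := by
      by_contra hcon
      push Not at hcon
      nlinarith
    exact_mod_cast this
  have hlow : ((m : ℝ) - 1) * l₁ ≤ l₂ := by
    have h1 : (m : ℝ) < l₂ / l₁ + 1 := Nat.ceil_lt_add_one (by apply div_nonneg <;> linarith)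
    have h2 : (m : ℝ) - 1 < l₂ / l₁ := by linarith
    rw [lt_div_iff₀ hl1pos] at h2
    exact h2.le
  set k := 5 * m / 2 with hk
  set H := ⌊M ^ (4 * m)⌋₊ with hH
  have hHlt : M ^ (4 * m) < (H : ℝ) + 1 := Nat.lt_floor_add_one _
  have hHle : (H : ℝ) ≤ Real.exp (4 * m * L) := by
    refine (Nat.floor_le (by positivity)).trans ?_
    rw [eM, ← Real.exp_nat_mul]; push_cast; rfl
  obtain ⟨A, B, hA, hB, hAB, hAH, hBH, hv⟩ := exists_siegel h hM hMα (by omega) hk hHlt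
  have hW := wronskian_ne_zero h (by omega : k < 4 * m) hA hB hAB hv
  have hbound := pow_le_of_vanishing hA hB hAH hBH hW hy₁ hco (x₂ / y₂ : ℚ)
  have hkm : (k + 1 : ℝ) ≤ 2 ^ m := by
    have h1 : ∀ n : ℕ, 9 ≤ n → 5 * n / 2 + 1 ≤ 2 ^ n := by
      intro n hn
      induction n, hn using Nat.le_induction with
      | base => norm_num
      | succ n hn ih => rw [pow_succ]; omega
    exact_mod_cast h1 m hm9
  have hR : 4 * ((k : ℝ) + 1) ^ 2 * (H : ℝ) ^ 2 ≤ Real.exp (8 * m * L + (2 * m + 2) * t) := by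
    calc 4 * ((k : ℝ) + 1) ^ 2 * (H : ℝ) ^ 2 ≤ 2 ^ 2 * (2 ^ m) ^ 2 * (Real.exp (4 * m * L)) ^ 2 := by
          norm_num only; gcongr
      _ = _ := by
          rw [e2, ← Real.exp_nat_mul, ← Real.exp_nat_mul, ← Real.exp_nat_mul, ← Real.exp_nat_mul,
            ← Real.exp_add, ← Real.exp_add, ← e2]
          congr 1; push_cast; ring
  set δ : ℕ → ℚ := fun j => (hasseDeriv j (A.map (Int.castRingHom ℚ) -
      C (x₂ / y₂ : ℚ) * B.map (Int.castRingHom ℚ))).eval (x₁ / y₁ : ℚ) with hδ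
  have hkey : ∀ T : ℕ, (∀ j ≤ T, δ j = 0) → (T : ℝ) * l₁ ≤ 8 * m * L + (2 * m + 2) * t := by
    intro T hT
    have h1 := (hbound T hT).trans hR
    rw [ey1, ← Real.exp_nat_mul] at h1
    exact Real.exp_le_exp.mp h1
  have hex : ∃ j, δ j ≠ 0 := by
    by_contra hcon
    push Not at hcon
    obtain ⟨T, hT⟩ := exists_nat_gt ((8 * m * L + (2 * m + 2) * t) / l₁)
    rw [div_lt_iff₀ hl1pos] at hT
    exact absurd (hkey T fun j _ => hcon j) (not_le.mpr hT)
  classical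
  set j := Nat.find hex with hjdef
  have hjne : δ j ≠ 0 := Nat.find_spec hex
  have hjl : (j : ℝ) * l₁ ≤ l₁ + 8 * m * L + (2 * m + 2) * t := by
    rcases Nat.eq_zero_or_pos j with h0 | h0
    · rw [h0, Nat.cast_zero, zero_mul]; positivity
    · have h1 := hkey (j - 1) fun i hi => not_not.mp (Nat.find_min hex (by omega : i < j))
      rw [Nat.cast_sub h0] at h1
      push_cast at h1
      linarith
  have hjm : j < m := by
    by_contra hcon
    push Not at hcon
    have h1 : (m : ℝ) ≤ j := by exact_mod_cast hcon
    have h2 : (9 : ℝ) ≤ m := by exact_mod_cast hm9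
    have h3 : (m : ℝ) * l₁ ≤ j * l₁ := by gcongr
    have h4 : (m : ℝ) * (5 * t) ≤ m * L := by gcongr
    have e5 : 0 ≤ (m - 1 : ℝ) * (l₁ - 210 * L) := mul_nonneg (by linarith) (by linarith)
    nlinarith
  have hbig := one_le_pow_mul_norm hA hB hy₁ hy₂ hjne
  -- quality of the approximations
  have happ : ∀ x y : ℤ, (0 : ℝ) < y → ‖(x : ℂ) - α s * y‖ ≤ M ^ 2 / y ^ 3 →
      ‖(x / y : ℂ) - α s‖ ≤ Real.exp (2 * L - 4 * Real.log y) := by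
    intro x y hy hxy
    have hyc : (y : ℂ) ≠ 0 := by
      have : y ≠ 0 := by rintro rfl; simp at hy
      exact_mod_cast this
    have h1 : (x / y : ℂ) - α s = (x - α s * y) / y := by field_simp
    rw [h1, norm_div, Complex.norm_intCast, abs_of_pos hy, div_le_iff₀ hy]
    refine hxy.trans (le_of_eq ?_)
    rw [Real.exp_sub, show 2 * L = ((2 : ℕ) : ℝ) * L by norm_num,
      show 4 * Real.log y = ((4 : ℕ) : ℝ) * Real.log y by norm_num,
      Real.exp_nat_mul, Real.exp_nat_mul, Real.exp_log hM0, Real.exp_log hy]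
    field_simp
  have ha1 := happ x₁ y₁ hy1r h₁
  have ha2 := happ x₂ y₂ hy2r h₂
  set ξ₁ : ℂ := (x₁ / y₁ : ℂ) with hξ₁
  set ξ₂ : ℂ := (x₂ / y₂ : ℂ) with hξ₂
  have hz : ‖ξ₁ - α s‖ ≤ 1 := by
    refine ha1.trans ?_
    rw [Real.exp_le_one_iff]; linarith
  have hα : max 1 ‖α s‖ ≤ M := by
    refine le_trans ?_ hMα
    rw [← Finset.mul_prod_erase _ _ (Finset.mem_univ s)]
    exact le_mul_of_one_le_right (by positivity)
      (Finset.prod_induction _ (fun x : ℝ => 1 ≤ x) (fun a b => one_le_mul_of_one_le_of_one_le) le_rfl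
        fun i _ => le_max_left _ _)
  have hξM : max 1 ‖ξ₁‖ ≤ 2 * M := by
    refine max_le (by linarith) ?_
    have : ‖ξ₁‖ ≤ ‖ξ₁ - α s‖ + ‖α s‖ := by
      simpa using norm_add_le (ξ₁ - α s) (α s)
    have := (le_max_right 1 ‖α s‖).trans hα
    linarith
  have hmk : m ≤ k := by omega
  have hT1 := norm_eval_hasseDeriv_sub_le hA hB hAH hBH (fun i hi => hv i hi s) hjm hmk hz
  have hT2 : ‖(hasseDeriv j (B.map (Int.castRingHom ℂ))).eval ξ₁‖ ≤ H * 2 ^ k * (2 * M) ^ k := by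
    have h1 := norm_aeval_hasseDeriv_le B j k hB H hBH ξ₁
    rw [aeval_def, algebraMap_int_eq, ← eval_map, map_hasseDeriv] at h1
    refine h1.trans ?_
    have h2 : max 1 ‖ξ₁‖ ^ (k - j) ≤ (2 * M) ^ k :=
      (pow_le_pow_left₀ (by positivity) hξM _).trans (pow_le_pow_right₀ (by linarith) (by omega))
    gcongr
  have hsplit : (hasseDeriv j (A.map (Int.castRingHom ℂ) - C ξ₂ * B.map (Int.castRingHom ℂ))).eval ξ₁
      = (hasseDeriv j (A.map (Int.castRingHom ℂ) - C (α s) * B.map (Int.castRingHom ℂ))).eval ξ₁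
        - (ξ₂ - α s) * (hasseDeriv j (B.map (Int.castRingHom ℂ))).eval ξ₁ := by
    simp only [map_sub, ← smul_eq_C_mul, map_smul, eval_sub, eval_smul, smul_eq_mul]
    ring
  rw [hsplit] at hbig
  have hN1 : ‖(hasseDeriv j (A.map (Int.castRingHom ℂ) - C (α s) * B.map (Int.castRingHom ℂ))).eval ξ₁‖
      ≤ Real.exp (4 * m * L + (2 * k + 1 : ℕ) * t + (k + 1 - m : ℕ) * L +
        (m - j : ℕ) * (2 * L - 4 * l₁)) := by
    refine hT1.trans ?_
    rw [Real.exp_add, Real.exp_add, Real.exp_add, Real.exp_nat_mul, Real.exp_nat_mul,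
      Real.exp_nat_mul, ← e2, ← eM]
    gcongr
  have hN2 : ‖(ξ₂ - α s) * (hasseDeriv j (B.map (Int.castRingHom ℂ))).eval ξ₁‖
      ≤ Real.exp ((2 * L - 4 * l₂) + (4 * m * L + k * t + k * (t + L))) := by
    rw [norm_mul, Real.exp_add]
    refine mul_le_mul ha2 (hT2.trans ?_) (norm_nonneg _) (Real.exp_pos _).le
    rw [Real.exp_add, Real.exp_add, Real.exp_nat_mul, Real.exp_nat_mul, Real.exp_add, ← e2, ← eM]
    gcongr
  have hS1 := Real.exp_lt_exp.mpr (exp_first_term hLpos ht hm9 hk hjm hl1 hup hjl)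
  have hS2 := Real.exp_lt_exp.mpr (exp_second_term hLpos ht hm9 hk hjm hl1 hlow)
  rw [Real.exp_add, Real.exp_add, Real.exp_nat_mul, ← ey1, ← ey2, Real.exp_neg, ← e2] at hS1 hS2
  have hfin := norm_sub_le
    ((hasseDeriv j (A.map (Int.castRingHom ℂ) - C (α s) * B.map (Int.castRingHom ℂ))).eval ξ₁)
    ((ξ₂ - α s) * (hasseDeriv j (B.map (Int.castRingHom ℂ))).eval ξ₁)
  have hpos : 0 < (y₁ : ℝ) ^ (k - j) * y₂ := by positivity
  have := mul_le_mul_of_nonneg_left (hfin.trans (add_le_add hN1 hN2)) hpos.le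
  rw [mul_add] at this
  linarith

/-- The binary quartic form attached to a quartic polynomial. -/
def formVal (f : ℤ[X]) (p : ℤ × ℤ) : ℤ :=
  ∑ i ∈ Finset.range 5, f.coeff i * p.1 ^ i * p.2 ^ (4 - i)

/-- Solutions of the Thue equation attached to a quartic polynomial. -/
def IsSol (f : ℤ[X]) (p : ℤ × ℤ) : Prop := formVal f p = 1 ∨ formVal f p = -1

/-- The linear form `x - α y` at `p = (x, y)`. -/
noncomputable def linForm (α : ℂ) (p : ℤ × ℤ) : ℂ := p.1 - α * p.2

theorem IsSol.isCoprime {f : ℤ[X]} {p : ℤ × ℤ} (hp : IsSol f p) : IsCoprime p.1 p.2 := by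
  have h1 : formVal f p = p.1 * (f.coeff 1 * p.2 ^ 3 + f.coeff 2 * p.1 * p.2 ^ 2 +
      f.coeff 3 * p.1 ^ 2 * p.2 + f.coeff 4 * p.1 ^ 3) + p.2 * (f.coeff 0 * p.2 ^ 3) := by
    simp [formVal, Finset.sum_range_succ]; ring
  set a := f.coeff 1 * p.2 ^ 3 + f.coeff 2 * p.1 * p.2 ^ 2 +
      f.coeff 3 * p.1 ^ 2 * p.2 + f.coeff 4 * p.1 ^ 3
  set b := f.coeff 0 * p.2 ^ 3
  rcases hp with hp | hp
  · exact ⟨a, b, by linarith⟩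
  · exact ⟨-a, -b, by linarith⟩

theorem IsRootSystem.formVal_eq {f : ℤ[X]} {α : Fin 4 → ℂ} (h : IsRootSystem f α) (p : ℤ × ℤ) :
    (formVal f p : ℂ) = ∏ i, linForm (α i) p := by
  by_cases hy : p.2 = 0
  · have h4 : f.coeff 4 = 1 := by
      have := h.monic.coeff_natDegree
      rwa [h.natDegree_eq] at this
    simp [formVal, linForm, hy, Finset.sum_range_succ, h4]
  · have hyc : (p.2 : ℂ) ≠ 0 := by exact_mod_cast hy
    have h1 : aeval (p.1 / p.2 : ℂ) f = ∏ i, ((p.1 / p.2 : ℂ) - α i) := by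
      have : aeval (p.1 / p.2 : ℂ) f = (f.map (Int.castRingHom ℂ)).eval (p.1 / p.2 : ℂ) := by
        rw [aeval_def, eval_map]; rfl
      rw [this, h.map_eq, eval_prod]; simp
    rw [aeval_eq_sum_range, h.natDegree_eq] at h1
    have h2 : (formVal f p : ℂ) = p.2 ^ 4 * ∑ i ∈ Finset.range (4 + 1),
        f.coeff i • (p.1 / p.2 : ℂ) ^ i := by
      simp [formVal, Finset.sum_range_succ]; field_simp
    rw [h2, h1, Fin.prod_univ_four, Fin.prod_univ_four]
    simp only [linForm]
    field_simp

theorem IsRootSystem.prod_norm_linForm {f : ℤ[X]} {α : Fin 4 → ℂ} (h : IsRootSystem f α)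
    {p : ℤ × ℤ} (hp : IsSol f p) : ∏ i, ‖linForm (α i) p‖ = 1 := by
  rw [← norm_prod, ← h.formVal_eq, Complex.norm_intCast]
  rcases hp with hp | hp <;> simp [hp]

/-- Vandermonde product of four complex numbers. -/
noncomputable def vdm (α : Fin 4 → ℂ) : ℝ :=
  ‖α 0 - α 1‖ * ‖α 0 - α 2‖ * ‖α 0 - α 3‖ * ‖α 1 - α 2‖ * ‖α 1 - α 3‖ * ‖α 2 - α 3‖

theorem norm_sub_le_mahler (a b : ℂ) : ‖a - b‖ ≤ 2 * (max 1 ‖a‖ * max 1 ‖b‖) := by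
  have h := norm_sub_le a b
  have ha := le_max_left 1 ‖a‖
  have hb := le_max_left 1 ‖b‖
  have ha' := le_max_right 1 ‖a‖
  have hb' := le_max_right 1 ‖b‖
  nlinarith

theorem vdm_three_le {a b c r M : ℝ} {x y z : ℂ} (hM : r * a * b * c ≤ M) (hr : 1 ≤ r)
    (ha : a = max 1 ‖x‖) (hb : b = max 1 ‖y‖) (hc : c = max 1 ‖z‖) :
    ‖x - y‖ * ‖x - z‖ * ‖y - z‖ ≤ 8 * M ^ 2 := by
  have ha1 : 1 ≤ a := ha ▸ le_max_left _ _
  have hb1 : 1 ≤ b := hb ▸ le_max_left _ _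
  have hc1 : 1 ≤ c := hc ▸ le_max_left _ _
  have h1 := norm_sub_le_mahler x y
  have h2 := norm_sub_le_mahler x z
  have h3 := norm_sub_le_mahler y z
  rw [← ha, ← hb] at h1
  rw [← ha, ← hc] at h2
  rw [← hb, ← hc] at h3
  have h0 : a * b * c ≤ M := by
    have : 1 * (a * b * c) ≤ r * (a * b * c) := by gcongr
    linarith
  calc ‖x - y‖ * ‖x - z‖ * ‖y - z‖ ≤ (2 * (a * b)) * (2 * (a * c)) * (2 * (b * c)) := by gcongr
    _ = 8 * (a * b * c) ^ 2 := by ring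
    _ ≤ _ := by gcongr

theorem le_prod_dist {α : Fin 4 → ℂ} {M : ℝ} (hM : ∏ i, max 1 ‖α i‖ ≤ M) (i : Fin 4) :
    vdm α ≤ (∏ j ∈ Finset.univ.erase i, ‖α i - α j‖) * (8 * M ^ 2) := by
  rw [Fin.prod_univ_four] at hM
  have g := fun i : Fin 4 => le_max_left 1 ‖α i‖
  have e0 : (Finset.univ : Finset (Fin 4)).erase 0 = {1, 2, 3} := by decide
  have e1 : (Finset.univ : Finset (Fin 4)).erase 1 = {0, 2, 3} := by decide
  have e2 : (Finset.univ : Finset (Fin 4)).erase 2 = {0, 1, 3} := by decide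
  have e3 : (Finset.univ : Finset (Fin 4)).erase 3 = {0, 1, 2} := by decide
  have key : ∀ A B T : ℝ, 0 ≤ A → T ≤ B → A * T ≤ A * B := fun A B T hA hT =>
    mul_le_mul_of_nonneg_left hT hA
  have hfin : i = 0 ∨ i = 1 ∨ i = 2 ∨ i = 3 := by fin_cases i <;> simp
  rcases hfin with rfl | rfl | rfl | rfl
  · have h1 := vdm_three_le (x := α 1) (y := α 2) (z := α 3) (r := max 1 ‖α 0‖) hM (g 0) rfl rfl rfl
    rw [e0, Finset.prod_insert (by decide), Finset.prod_insert (by decide), Finset.prod_singleton]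
    refine le_trans (le_of_eq ?_) (mul_le_mul_of_nonneg_left h1 (by positivity))
    rw [vdm]; ring
  · have h1 := vdm_three_le (x := α 0) (y := α 2) (z := α 3) (r := max 1 ‖α 1‖)
      (le_trans (le_of_eq (by ring)) hM) (g 1) rfl rfl rfl
    rw [e1, Finset.prod_insert (by decide), Finset.prod_insert (by decide), Finset.prod_singleton]
    refine le_trans (le_of_eq ?_) (mul_le_mul_of_nonneg_left h1 (by positivity))
    rw [vdm, norm_sub_rev (α 1) (α 0)]; ring
  · have h1 := vdm_three_le (x := α 0) (y := α 1) (z := α 3) (r := max 1 ‖α 2‖)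
      (le_trans (le_of_eq (by ring)) hM) (g 2) rfl rfl rfl
    rw [e2, Finset.prod_insert (by decide), Finset.prod_insert (by decide), Finset.prod_singleton]
    refine le_trans (le_of_eq ?_) (mul_le_mul_of_nonneg_left h1 (by positivity))
    rw [vdm, norm_sub_rev (α 2) (α 0), norm_sub_rev (α 2) (α 1)]; ring
  · have h1 := vdm_three_le (x := α 0) (y := α 1) (z := α 2) (r := max 1 ‖α 3‖)
      (le_trans (le_of_eq (by ring)) hM) (g 3) rfl rfl rfl
    rw [e3, Finset.prod_insert (by decide), Finset.prod_insert (by decide), Finset.prod_singleton]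
    refine le_trans (le_of_eq ?_) (mul_le_mul_of_nonneg_left h1 (by positivity))
    rw [vdm, norm_sub_rev (α 3) (α 0), norm_sub_rev (α 3) (α 1), norm_sub_rev (α 3) (α 2)]; ring

/-- `i` is the index of a root for which the linear form is smallest. -/
def IsNearest (α : Fin 4 → ℂ) (p : ℤ × ℤ) (i : Fin 4) : Prop :=
  ∀ j, ‖linForm (α i) p‖ ≤ ‖linForm (α j) p‖

theorem exists_isNearest (α : Fin 4 → ℂ) (p : ℤ × ℤ) : ∃ i, IsNearest α p i := by
  obtain ⟨i, -, hi⟩ := Finset.exists_min_image Finset.univ (fun i => ‖linForm (α i) p‖)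
    Finset.univ_nonempty
  exact ⟨i, fun j => hi j (Finset.mem_univ j)⟩

theorem IsRootSystem.norm_linForm_le {f : ℤ[X]} {α : Fin 4 → ℂ} (h : IsRootSystem f α) {M : ℝ}
    (hM : ∏ i, max 1 ‖α i‖ ≤ M) (hV : 5 ^ 6 ≤ vdm α) {p : ℤ × ℤ} (hp : IsSol f p)
    (hy : 0 < p.2) {i : Fin 4} (hi : IsNearest α p i) :
    ‖linForm (α i) p‖ ≤ (64 * M ^ 2 / 15625) / p.2 ^ 3 := by
  have hyr : (0 : ℝ) < p.2 := by exact_mod_cast hy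
  have h1 := h.prod_norm_linForm hp
  rw [← Finset.mul_prod_erase _ _ (Finset.mem_univ i)] at h1
  have h2 : ∏ j ∈ Finset.univ.erase i, (‖α i - α j‖ * (p.2 / 2)) ≤
      ∏ j ∈ Finset.univ.erase i, ‖linForm (α j) p‖ := by
    refine Finset.prod_le_prod (fun j _ => by positivity) fun j _ => ?_
    have h3 : (α i - α j) * p.2 = linForm (α j) p - linForm (α i) p := by
      simp only [linForm]; ring
    have h4 := congrArg norm h3
    rw [norm_mul, Complex.norm_intCast, abs_of_pos hyr] at h4
    have h5 := norm_sub_le (linForm (α j) p) (linForm (α i) p)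
    have := hi j
    linarith
  rw [Finset.prod_mul_distrib, Finset.prod_const, Finset.card_erase_of_mem (Finset.mem_univ i),
    Finset.card_univ, Fintype.card_fin] at h2
  have h3 := le_prod_dist hM i
  set D := ∏ j ∈ Finset.univ.erase i, ‖α i - α j‖
  set P := ∏ j ∈ Finset.univ.erase i, ‖linForm (α j) p‖
  set l := ‖linForm (α i) p‖
  have hl : 0 ≤ l := norm_nonneg _
  have hM2 : 0 < M ^ 2 := by
    have : 1 ≤ M := le_trans (Finset.prod_induction _ (fun x : ℝ => 1 ≤ x)
      (fun a b => one_le_mul_of_one_le_of_one_le) le_rfl fun i _ => le_max_left _ _) hM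
    positivity
  rw [le_div_iff₀ (by positivity)]
  norm_num at h2
  have h6 : l * (D * (p.2 / 2) ^ 3) ≤ 1 := by
    rw [← h1]; gcongr
  have h7 : 15625 ≤ D * (8 * M ^ 2) := le_trans (by norm_num) (hV.trans h3)
  have h8 : 15625 * (l * p.2 ^ 3) ≤ D * (8 * M ^ 2) * (l * p.2 ^ 3) := by gcongr
  have h9 : D * (8 * M ^ 2) * (l * p.2 ^ 3) = 64 * M ^ 2 * (l * (D * (p.2 / 2) ^ 3)) := by ring
  have h10 : 64 * M ^ 2 * (l * (D * (p.2 / 2) ^ 3)) ≤ 64 * M ^ 2 * 1 := by gcongr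
  linarith

theorem one_le_of_ne {a : ℂ} {p q : ℤ × ℤ} (hp : IsCoprime p.1 p.2) (hq : IsCoprime q.1 q.2)
    (hyp : 0 < p.2) (hyq : 0 < q.2) (hpq : p ≠ q) :
    1 ≤ ‖linForm a p‖ * q.2 + ‖linForm a q‖ * p.2 := by
  have h0 : p.1 * q.2 - q.1 * p.2 ≠ 0 := by
    intro h0
    have h1 : p.1 * q.2 = q.1 * p.2 := by linarith
    have h2 : p.2 ∣ q.2 := hp.symm.dvd_of_dvd_mul_left ⟨q.1, by linarith⟩
    have h3 : q.2 ∣ p.2 := hq.symm.dvd_of_dvd_mul_left ⟨p.1, by linarith⟩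
    have h4 : p.2 = q.2 := Int.dvd_antisymm hyp.le hyq.le h2 h3
    rw [h4] at h1
    exact hpq (Prod.ext (mul_right_cancel₀ hyq.ne' h1) h4)
  have h1 : ((p.1 * q.2 - q.1 * p.2 : ℤ) : ℂ) = linForm a p * q.2 - linForm a q * p.2 := by
    simp only [linForm]; push_cast; ring
  have h2 : (1 : ℝ) ≤ ‖((p.1 * q.2 - q.1 * p.2 : ℤ) : ℂ)‖ := by
    rw [Complex.norm_intCast]; exact_mod_cast Int.one_le_abs h0
  rw [h1] at h2
  refine h2.trans ((norm_sub_le _ _).trans (le_of_eq ?_))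
  rw [norm_mul, norm_mul, Complex.norm_intCast, Complex.norm_intCast,
    abs_of_pos (by exact_mod_cast hyq), abs_of_pos (by exact_mod_cast hyp)]

theorem gap_principle {a : ℂ} {κ : ℝ} {p q : ℤ × ℤ} (hp : IsCoprime p.1 p.2)
    (hq : IsCoprime q.1 q.2)
    (hyp : 0 < p.2) (hyq : 0 < q.2) (hpq : p ≠ q) (hap : ‖linForm a p‖ ≤ κ / p.2 ^ 3)
    (haq : ‖linForm a q‖ ≤ κ / q.2 ^ 3) :
    (p.2 : ℝ) ^ 3 * q.2 ^ 3 ≤ κ * (p.2 ^ 4 + q.2 ^ 4) := by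
  have h1 := one_le_of_ne (a := a) hp hq hyp hyq hpq
  have hpr : (0 : ℝ) < p.2 := by exact_mod_cast hyp
  have hqr : (0 : ℝ) < q.2 := by exact_mod_cast hyq
  have h2 : 1 ≤ κ / p.2 ^ 3 * q.2 + κ / q.2 ^ 3 * p.2 := h1.trans (by gcongr)
  have h3 : κ / p.2 ^ 3 * q.2 + κ / q.2 ^ 3 * p.2 =
      κ * (p.2 ^ 4 + q.2 ^ 4) / ((p.2 : ℝ) ^ 3 * q.2 ^ 3) := by field_simp; ring
  rw [h3, le_div_iff₀ (by positivity)] at h2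
  linarith

theorem gap_cubic {κ y z : ℝ} (hκ : 0 < κ) (hy : 0 < y) (hyz : y ≤ z) (h7 : 7 * κ ≤ y ^ 2)
    (h : y ^ 3 * z ^ 3 ≤ κ * (y ^ 4 + z ^ 4)) : 99 / 100 * y ^ 3 ≤ κ * z := by
  have hz : 0 < z := hy.trans_le hyz
  have key : ∀ c, 0 ≤ c → κ * y ^ 4 ≤ c * (y ^ 3 * z ^ 3) → (1 - c) * y ^ 3 ≤ κ * z := by
    intro c _ hc
    have h1 : (1 - c) * y ^ 3 * z ^ 3 ≤ κ * z * z ^ 3 := by nlinarith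
    exact le_of_mul_le_mul_right h1 (by positivity)
  have h6 : 6 / 7 * y ^ 3 ≤ κ * z := by
    have := key (1 / 7) (by norm_num) ?_
    · linarith
    · have h1 : y ^ 4 * (7 * κ) ≤ y ^ 4 * y ^ 2 := by gcongr
      have h2 : y ^ 3 * y ^ 3 ≤ y ^ 3 * z ^ 3 := by gcongr
      nlinarith
  have hz6 : 6 * y ≤ z := by
    have h1 : κ * (6 * y) ≤ κ * z := by
      have : y * (7 * κ) ≤ y * y ^ 2 := by gcongr
      nlinarith
    exact le_of_mul_le_mul_left h1 hκ
  have := key (1 / 100) (by norm_num) ?_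
  · linarith
  · have h1 : y ^ 4 * (7 * κ) ≤ y ^ 4 * y ^ 2 := by gcongr
    have h2 : y ^ 3 * (6 * y) ^ 3 ≤ y ^ 3 * z ^ 3 := by gcongr
    nlinarith [pow_pos hy 6]

theorem exists_max_triple {ι : Type*} [DecidableEq ι] {v : ι → ℝ} {Λ : ℝ} (n : ℕ)
    (S : Finset ι) (hS : n < S.card) (hv : ∀ p ∈ S, Λ ≤ v p)
    (hgap : ∀ p ∈ S, ∀ q ∈ S, p ≠ q → v p ≤ v q → 3 * v p ≤ v q) :
    ∃ p ∈ S, (∀ q ∈ S, v q ≤ v p) ∧ 3 ^ n * Λ ≤ v p := by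
  induction n generalizing S with
  | zero =>
    obtain ⟨p, hp, hmax⟩ := Finset.exists_max_image S v (Finset.card_pos.mp hS)
    exact ⟨p, hp, hmax, by simpa using hv p hp⟩
  | succ n ih =>
    obtain ⟨p, hp, hmax⟩ := Finset.exists_max_image S v (Finset.card_pos.mp (by omega))
    obtain ⟨q, hq, -, hqΛ⟩ := ih (S.erase p) (by rw [Finset.card_erase_of_mem hp]; omega)
      (fun r hr => hv r (Finset.mem_of_mem_erase hr))
      (fun r hr s hs => hgap r (Finset.mem_of_mem_erase hr) s (Finset.mem_of_mem_erase hs))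
    refine ⟨p, hp, hmax, ?_⟩
    have := hgap q (Finset.mem_of_mem_erase hq) p hp (Finset.ne_of_mem_erase hq)
      (hmax q (Finset.mem_of_mem_erase hq))
    rw [pow_succ]; linarith

theorem exists_max_prod_erase_le {ι : Type*} [DecidableEq ι] {y w : ι → ℝ} (S : Finset ι)
    (hS : S.Nonempty) (hy : ∀ p ∈ S, 1 ≤ y p) (hw : ∀ p ∈ S, 0 ≤ w p)
    (hgap : ∀ p ∈ S, ∀ q ∈ S, p ≠ q → y p ≤ y q → y p * w p ≤ y q) :
    ∃ m ∈ S, (∀ q ∈ S, y q ≤ y m) ∧ ∏ p ∈ S.erase m, w p ≤ y m := by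
  induction hn : S.card generalizing S with
  | zero => simp at hn; exact absurd hn hS.ne_empty
  | succ n ih =>
    obtain ⟨m, hm, hmax⟩ := Finset.exists_max_image S y hS
    refine ⟨m, hm, hmax, ?_⟩
    rcases (S.erase m).eq_empty_or_nonempty with h0 | h0
    · rw [h0]; simpa using hy m hm
    · obtain ⟨q, hq, -, hprod⟩ := ih (S.erase m) h0
        (fun r hr => hy r (Finset.mem_of_mem_erase hr))
        (fun r hr => hw r (Finset.mem_of_mem_erase hr))
        (fun r hr s hs => hgap r (Finset.mem_of_mem_erase hr) s (Finset.mem_of_mem_erase hs))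
        (by rw [Finset.card_erase_of_mem hm]; omega)
      have hqS := Finset.mem_of_mem_erase hq
      rw [← Finset.mul_prod_erase _ _ hq]
      have h1 := hgap q hqS m hm (Finset.ne_of_mem_erase hq) (hmax q hqS)
      have h2 : w q * ∏ x ∈ (S.erase m).erase q, w x ≤ w q * y q :=
        mul_le_mul_of_nonneg_left hprod (hw q hqS)
      linarith

/-- There are at most eight large solutions near a given root. -/
theorem card_large_le {f : ℤ[X]} {α : Fin 4 → ℂ} (h : IsRootSystem f α) {M κ : ℝ} (hM : 32 ≤ M)
    (hMα : ∏ i, max 1 ‖α i‖ ≤ M) (i : Fin 4) (hκ : 1 ≤ κ) (hκM : κ ≤ 99 / 100 * M ^ 2)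
    (S : Finset (ℤ × ℤ)) (hco : ∀ p ∈ S, IsCoprime p.1 p.2) (hpos : ∀ p ∈ S, 0 < p.2)
    (happ : ∀ p ∈ S, ‖linForm (α i) p‖ ≤ κ / p.2 ^ 3)
    (hlarge : ∀ p ∈ S, M ^ 140 ≤ (99 / 100 * (p.2 : ℝ) ^ 2 / κ) ^ 243) : S.card ≤ 8 := by
  by_contra hcard
  push Not at hcard
  have hM0 : 0 < M := by linarith
  have hκ0 : 0 < κ := by linarith
  have hposr : ∀ p ∈ S, (0 : ℝ) < p.2 := fun p hp => by exact_mod_cast hpos p hp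
  have hL : 0 < Real.log M := Real.log_pos (by linarith)
  set c := Real.log (κ / (99 / 100)) / 2 with hc
  have hc0 : 0 ≤ c := by
    have : 0 ≤ Real.log (κ / (99 / 100)) := Real.log_nonneg (by rw [le_div_iff₀] <;> linarith)
    linarith
  have hcM : c ≤ Real.log M := by
    have h1 : Real.log (κ / (99 / 100)) ≤ Real.log (M ^ 2) :=
      Real.log_le_log (by positivity) (by rw [div_le_iff₀ (by norm_num)]; linarith)
    rw [Real.log_pow] at h1
    push_cast at h1
    linarith
  set v : ℤ × ℤ → ℝ := fun p => Real.log p.2 - c with hv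
  have hseven : ∀ p ∈ S, 7 * κ ≤ (p.2 : ℝ) ^ 2 := by
    intro p hp
    by_contra hcon
    push Not at hcon
    have h1 := hlarge p hp
    have h2 : 99 / 100 * (p.2 : ℝ) ^ 2 / κ ≤ 693 / 100 := by
      rw [div_le_iff₀ hκ0]; linarith
    have h3 : (99 / 100 * (p.2 : ℝ) ^ 2 / κ) ^ 243 ≤ (693 / 100) ^ 243 := by
      have : 0 ≤ 99 / 100 * (p.2 : ℝ) ^ 2 / κ := by positivity
      gcongr
    have h4 : (32 : ℝ) ^ 140 ≤ M ^ 140 := by gcongr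
    have h5 : (693 / 100 : ℝ) ^ 243 < 32 ^ 140 := by norm_num
    linarith
  have hgap : ∀ p ∈ S, ∀ q ∈ S, p ≠ q → v p ≤ v q → 3 * v p ≤ v q := by
    intro p hp q hq hpq hle
    have hyz : (p.2 : ℝ) ≤ q.2 := by
      rw [← Real.log_le_log_iff (hposr p hp) (hposr q hq)]
      simp only [hv] at hle; linarith
    have h1 := gap_cubic hκ0 (hposr p hp) hyz (hseven p hp)
      (gap_principle (hco p hp) (hco q hq) (hpos p hp) (hpos q hq) hpq (happ p hp) (happ q hq))
    have h2 : (p.2 : ℝ) ^ 3 ≤ κ / (99 / 100) * q.2 := by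
      rw [div_mul_eq_mul_div, le_div_iff₀ (by norm_num)]; linarith
    have h3 := Real.log_le_log (pow_pos (hposr p hp) 3) h2
    rw [Real.log_pow, Real.log_mul (by positivity) (hposr q hq).ne'] at h3
    push_cast at h3
    simp only [hv]; linarith
  have hΛ : ∀ p ∈ S, 70 / 243 * Real.log M ≤ v p := by
    intro p hp
    have hp0 := hposr p hp
    have h1 := Real.log_le_log (by positivity) (hlarge p hp)
    have h2 : 99 / 100 * (p.2 : ℝ) ^ 2 / κ = p.2 ^ 2 / (κ / (99 / 100)) := by field_simp
    rw [h2, Real.log_pow, Real.log_pow, Real.log_div (by positivity) (by positivity),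
      Real.log_pow] at h1
    push_cast at h1
    simp only [hv]; linarith
  obtain ⟨p₉, hp₉, hmax₉⟩ := Finset.exists_max_image S v (Finset.card_pos.mp (by omega))
  have hsub : ∀ p ∈ S.erase p₉, p ∈ S := fun p hp => Finset.mem_of_mem_erase hp
  have hcard₈ : 7 < (S.erase p₉).card := by rw [Finset.card_erase_of_mem hp₉]; omega
  obtain ⟨p₈, hp₈, hmax₈⟩ := Finset.exists_max_image (S.erase p₉) v (Finset.card_pos.mp (by omega))
  have hsub' : ∀ p ∈ (S.erase p₉).erase p₈, p ∈ S := fun p hp => hsub p (Finset.mem_of_mem_erase hp)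
  obtain ⟨p₇, hp₇, -, hbig⟩ := exists_max_triple (Λ := 70 / 243 * Real.log M) 6
    ((S.erase p₉).erase p₈) (by rw [Finset.card_erase_of_mem hp₈]; omega)
    (fun p hp => hΛ p (hsub' p hp))
    (fun p hp q hq => hgap p (hsub' p hp) q (hsub' q hq))
  have h78 := hgap p₇ (hsub' _ hp₇) p₈ (hsub _ hp₈) (Finset.ne_of_mem_erase hp₇)
    (hmax₈ _ (Finset.mem_of_mem_erase hp₇))
  have h89 := hgap p₈ (hsub _ hp₈) p₉ hp₉ (Finset.ne_of_mem_erase hp₈) (hmax₉ _ (hsub _ hp₈))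
  have hq : ∀ p ∈ S, ‖(p.1 : ℂ) - α i * p.2‖ ≤ M ^ 2 / p.2 ^ 3 := by
    intro p hp
    have hp0 := hposr p hp
    refine (happ p hp).trans ?_
    gcongr
    nlinarith
  simp only [hv] at hbig h78 h89
  exact thue_pair h hM hMα i (hco p₇ (hsub' _ hp₇)) (hpos p₇ (hsub' _ hp₇)) (hpos p₉ hp₉)
    (hq p₇ (hsub' _ hp₇)) (hq p₉ hp₉) (by linarith) (by linarith)

/-- A quartic with large discriminant whose Mahler measure is almost minimal among the
quartics obtained from unimodular substitutions. -/
structure IsReduced (f : ℤ[X]) (α : Fin 4 → ℂ) (M : ℝ) : Prop where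
  isRootSystem : IsRootSystem f α
  mahler_le : ∏ i, max 1 ‖α i‖ ≤ M
  le_vdm : 5 ^ 6 ≤ vdm α
  le_mahler : ∀ p q : ℤ × ℤ, IsSol f p → p.1 * q.2 - q.1 * p.2 = 1 →
    M ≤ ∏ i, max 1 ‖linForm (α i) q / linForm (α i) p‖ + 1 / 100

/-- The quality of a solution as an approximation to a root. -/
noncomputable def weight (a : ℂ) (p : ℤ × ℤ) : ℝ := max 1 (1 / (2 * (p.2 * ‖linForm a p‖)))

theorem one_le_weight (a : ℂ) (p : ℤ × ℤ) : 1 ≤ weight a p := le_max_left _ _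

theorem weight_eq_one {a : ℂ} {p : ℤ × ℤ} (h : 1 / 2 ≤ p.2 * ‖linForm a p‖) : weight a p = 1 := by
  refine max_eq_left ?_
  rw [div_le_one (by linarith)]; linarith

theorem exists_complement {p : ℤ × ℤ} (hp : IsCoprime p.1 p.2) (hy : 0 < p.2) :
    ∃ q : ℤ × ℤ, p.1 * q.2 - q.1 * p.2 = 1 ∧ 2 * |q.2| ≤ p.2 := by
  obtain ⟨u, v, huv⟩ := hp
  refine ⟨(-v - p.1 * ((u - u.bmod p.2.toNat) / p.2), u.bmod p.2.toNat), ?_, ?_⟩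
  · have h1 : p.2 ∣ u - u.bmod p.2.toNat := by
      have := Int.dvd_self_sub_bmod (x := u) (m := p.2.toNat)
      rwa [Int.toNat_of_nonneg hy.le] at this
    have h2 := Int.ediv_mul_cancel h1
    simp only
    linear_combination huv + p.1 * h2
  · have hm : 0 < p.2.toNat := by omega
    have h1 := Int.le_bmod (x := u) hm
    have h2 := Int.bmod_lt (x := u) hm
    simp only
    rcases abs_cases (u.bmod p.2.toNat) with ⟨h, -⟩ | ⟨h, -⟩ <;> omega

theorem IsReduced.le_prod_weight {f : ℤ[X]} {α : Fin 4 → ℂ} {M : ℝ} (h : IsReduced f α M)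
    {p : ℤ × ℤ} (hp : IsSol f p) (hy : 0 < p.2) :
    M ≤ 125 / 8 * ∏ i, weight (α i) p + 1 / 100 := by
  obtain ⟨q, hdet, hq⟩ := exists_complement hp.isCoprime hy
  have hyr : (0 : ℝ) < p.2 := by exact_mod_cast hy
  have hprod := h.isRootSystem.prod_norm_linForm hp
  have hL : ∀ i, 0 < ‖linForm (α i) p‖ := by
    intro i
    refine (norm_nonneg _).lt_of_ne fun h0 => ?_
    rw [Finset.prod_eq_zero (Finset.mem_univ i) h0.symm] at hprod
    exact zero_ne_one hprod
  set r : ℝ := |(q.2 : ℝ)| / p.2 with hr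
  have hbeta : ∀ i, ‖linForm (α i) q / linForm (α i) p‖ ≤ 1 / (p.2 * ‖linForm (α i) p‖) + r := by
    intro i
    have hLc : linForm (α i) p ≠ 0 := norm_pos_iff.mp (hL i)
    have hyc : (p.2 : ℂ) ≠ 0 := by exact_mod_cast hy.ne'
    have hdc : (p.1 : ℂ) * q.2 - q.1 * p.2 = 1 := by exact_mod_cast hdet
    have h1 : linForm (α i) q / linForm (α i) p = q.2 / p.2 - 1 / (p.2 * linForm (α i) p) := by
      field_simp
      simp only [linForm]
      linear_combination - hdc
    rw [h1]
    refine (norm_sub_le _ _).trans (le_of_eq ?_)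
    rw [norm_div, norm_div, norm_mul, Complex.norm_intCast, Complex.norm_intCast, abs_of_pos hyr,
      norm_one, add_comm]
  have hr2 : r ≤ 1 / 2 := by
    rw [hr, div_le_iff₀ hyr]
    have : (2 : ℝ) * |(q.2 : ℝ)| ≤ p.2 := by exact_mod_cast hq
    linarith
  obtain ⟨i₀, hi₀⟩ : ∃ i, 1 ≤ ‖linForm (α i) p‖ := by
    by_contra hcon
    push Not at hcon
    have : ∏ i, ‖linForm (α i) p‖ < ∏ i : Fin 4, (1 : ℝ) :=
      Finset.prod_lt_prod_of_nonempty (fun i _ => hL i) (fun i _ => hcon i) Finset.univ_nonempty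
    simp [hprod] at this
  have hfac : ∀ i, max 1 ‖linForm (α i) q / linForm (α i) p‖ ≤
      (if i = i₀ then 1 else 5 / 2) * weight (α i) p := by
    intro i
    have hw := one_le_weight (α i) p
    have hu : 0 < p.2 * ‖linForm (α i) p‖ := mul_pos hyr (hL i)
    split_ifs with hi
    · subst hi
      rw [one_mul]
      refine max_le hw ((hbeta i).trans (le_trans ?_ hw))
      have hu1 : (p.2 : ℝ) ≤ p.2 * ‖linForm (α i) p‖ := le_mul_of_one_le_right hyr.le hi₀
      rcases (by omega : p.2 = 1 ∨ 2 ≤ p.2) with h1 | h1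
      · have h0 : q.2 = 0 := by rw [h1] at hq; have := abs_nonneg q.2; exact abs_eq_zero.mp (by omega)
        rw [hr, h0]
        simp only [Int.cast_zero, abs_zero, zero_div, add_zero]
        rw [div_le_one hu]
        exact le_trans (by rw [h1]; simp) hu1
      · have h2 : (2 : ℝ) ≤ p.2 := by exact_mod_cast h1
        have : 1 / (p.2 * ‖linForm (α i) p‖) ≤ 1 / 2 :=
          one_div_le_one_div_of_le (by norm_num) (h2.trans hu1)
        linarith
    · refine max_le (by linarith) ((hbeta i).trans ?_)
      set u := p.2 * ‖linForm (α i) p‖ with hudef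
      by_cases hu2 : u ≤ 1 / 2
      · have h1 : 1 / (2 * u) ≤ weight (α i) p := le_max_right _ _
        have h2 : 1 / u = 2 * (1 / (2 * u)) := by field_simp
        linarith
      · have : 1 / u ≤ 2 := by
          rw [div_le_iff₀ hu]; push Not at hu2; linarith
        linarith
  refine (h.le_mahler p q hp hdet).trans ?_
  have h1 := Finset.prod_le_prod (s := Finset.univ) (fun i _ => by positivity) fun i _ => hfac i
  rw [Finset.prod_mul_distrib] at h1
  have h2 : ∏ i, (if i = i₀ then (1 : ℝ) else 5 / 2) = 125 / 8 := by
    rw [← Finset.mul_prod_erase _ _ (Finset.mem_univ i₀), if_pos rfl,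
      Finset.prod_congr rfl fun i hi => if_neg (Finset.ne_of_mem_erase hi), Finset.prod_const,
      Finset.card_erase_of_mem (Finset.mem_univ i₀), Finset.card_univ, Fintype.card_fin]
    norm_num
  rw [h2] at h1
  linarith

/-- For a polynomial of not too small Mahler measure, distinct solutions with the same second
coordinate are close to different roots. -/
theorem IsReduced.eq_of_isNearest {f : ℤ[X]} {α : Fin 4 → ℂ} {M : ℝ} (h : IsReduced f α M)
    (hM : 20 < M) {p q : ℤ × ℤ} (hp : IsSol f p) (hq : IsSol f q) (hy : 0 < p.2)
    (hpq : p.2 = q.2) {i : Fin 4} (hpi : IsNearest α p i) (hqi : IsNearest α q i) : p = q := by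
  by_contra hne
  have key : ∀ p : ℤ × ℤ, IsSol f p → 0 < p.2 → IsNearest α p i → ‖linForm (α i) p‖ < 1 / 2 := by
    intro p hp hy hpi
    by_contra hcon
    push Not at hcon
    have hy1 : (1 : ℝ) ≤ p.2 := by exact_mod_cast hy
    have h1 : ∏ j, weight (α j) p = 1 := Finset.prod_eq_one fun j _ => by
      have := hpi j
      exact weight_eq_one (by nlinarith)
    have := h.le_prod_weight hp hy
    rw [h1] at this
    linarith
  have h1 := key p hp hy hpi
  have h2 := key q hq (hpq ▸ hy) hqi
  have h3 : p.1 - q.1 ≠ 0 := fun h0 => hne (Prod.ext (by linarith) hpq)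
  have h4 : (1 : ℝ) ≤ ‖((p.1 - q.1 : ℤ) : ℂ)‖ := by
    rw [Complex.norm_intCast]; exact_mod_cast Int.one_le_abs h3
  have h5 : ((p.1 - q.1 : ℤ) : ℂ) = linForm (α i) p - linForm (α i) q := by
    simp only [linForm, hpq]; push_cast; ring
  rw [h5] at h4
  have := norm_sub_le (linForm (α i) p) (linForm (α i) q)
  linarith

/-- The index of a nearest root. -/
noncomputable def nearest (α : Fin 4 → ℂ) (p : ℤ × ℤ) : Fin 4 := (exists_isNearest α p).choose

theorem isNearest_nearest (α : Fin 4 → ℂ) (p : ℤ × ℤ) : IsNearest α p (nearest α p) :=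
  (exists_isNearest α p).choose_spec

theorem card_le_of_forall_nearest (α : Fin 4 → ℂ) (S : Finset (ℤ × ℤ)) (c : ℕ)
    (hc : ∀ i, (S.filter fun p => nearest α p = i).card ≤ c) : S.card ≤ 4 * c := by
  rw [Finset.card_eq_sum_card_fiberwise (f := nearest α) (t := Finset.univ)
    (fun _ _ => Finset.mem_coe.mpr (Finset.mem_univ _))]
  refine (Finset.sum_le_card_nsmul _ _ c fun i _ => hc i).trans (le_of_eq ?_)
  simp

theorem IsReduced.card_le_four {f : ℤ[X]} {α : Fin 4 → ℂ} {M : ℝ} (h : IsReduced f α M)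
    (hM : 20 < M) {y : ℤ} (hy : 0 < y) (S : Finset (ℤ × ℤ)) (hS : ∀ p ∈ S, IsSol f p ∧ p.2 = y) :
    S.card ≤ 4 := by
  refine card_le_of_forall_nearest α S 1 fun i => Finset.card_le_one.mpr fun p hp q hq => ?_
  rw [Finset.mem_filter] at hp hq
  obtain ⟨hp, hpi⟩ := hp
  obtain ⟨hq, hqi⟩ := hq
  exact h.eq_of_isNearest hM (hS p hp).1 (hS q hq).1 ((hS p hp).2 ▸ hy)
    ((hS p hp).2.trans (hS q hq).2.symm) (hpi ▸ isNearest_nearest α p) (hqi ▸ isNearest_nearest α q)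

theorem card_le_eight_of_snd_eq_one {f : ℤ[X]} (hdeg : f.natDegree = 4) (S : Finset (ℤ × ℤ))
    (hS : ∀ p ∈ S, IsSol f p ∧ p.2 = 1) : S.card ≤ 8 := by
  classical
  have hne : ∀ c : ℤ, f - C c ≠ 0 := by
    intro c h0
    rw [sub_eq_zero.mp h0, natDegree_C] at hdeg
    omega
  have hg : (f - C 1) * (f - C (-1)) ≠ 0 := mul_ne_zero (hne 1) (hne (-1))
  have hval : ∀ p ∈ S, formVal f p = f.eval p.1 := by
    intro p hp
    rw [eval_eq_sum_range, hdeg, formVal, (hS p hp).2]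
    simp
  have h1 : S.card ≤ ((f - C 1) * (f - C (-1))).roots.toFinset.card := by
    refine Finset.card_le_card_of_injOn Prod.fst (fun p hp => ?_) fun p hp q hq hpq =>
      Prod.ext hpq ((hS p hp).2.trans (hS q hq).2.symm)
    rw [Finset.mem_coe, Multiset.mem_toFinset, mem_roots hg, IsRoot.def, eval_mul, eval_sub,
      eval_sub, eval_C, eval_C, ← hval p hp]
    rcases (hS p hp).1 with h | h <;> rw [h] <;> norm_num
  refine h1.trans ((Multiset.toFinset_card_le _).trans ((card_roots' _).trans ?_))
  refine natDegree_mul_le.trans ?_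
  rw [natDegree_sub_C, natDegree_sub_C, hdeg]

/-- Solutions of moderate size near a given root. -/
theorem IsReduced.card_le_nine {f : ℤ[X]} {α : Fin 4 → ℂ} {M : ℝ} (h : IsReduced f α M)
    {κ : ℝ} (hκ : 1 ≤ κ) (hκ2 : κ ≤ 1000) (hκM : 64 * M ^ 2 / 15625 ≤ κ) (hM : M ≤ 32) {a b : ℤ}
    (ha : 1 ≤ a) (hb : (32 : ℝ) ^ 140 ≤ (99 / 100 * (b : ℝ) ^ 2 / κ) ^ 243)
    (hab : ∀ y z : ℤ, a ≤ y → y < b → a ≤ z → z < b →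
      κ * ((y : ℝ) ^ 4 + z ^ 4) < y ^ 3 * z ^ 3) (hb0 : 0 ≤ b)
    (S : Finset (ℤ × ℤ)) (hS : ∀ p ∈ S, IsSol f p ∧ a ≤ p.2) : S.card ≤ 4 * 9 := by
  refine card_le_of_forall_nearest α S 9 fun i => ?_
  have hS' : ∀ p ∈ S.filter fun p => nearest α p = i, IsSol f p ∧ a ≤ p.2 ∧
      ‖linForm (α i) p‖ ≤ κ / p.2 ^ 3 := by
    intro p hp
    rw [Finset.mem_filter] at hp
    obtain ⟨hp, hpi⟩ := hp
    obtain ⟨h1, h2⟩ := hS p hp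
    have h3 : (0 : ℝ) < p.2 := by exact_mod_cast (by omega : 0 < p.2)
    refine ⟨h1, h2, (h.isRootSystem.norm_linForm_le h.mahler_le h.le_vdm h1 (by omega)
      (hpi ▸ isNearest_nearest α p)).trans ?_⟩
    gcongr
  rw [← Finset.card_filter_add_card_filter_not (fun p : ℤ × ℤ => p.2 < b)]
  have hsmall : ((S.filter fun p => nearest α p = i).filter fun p => p.2 < b).card ≤ 1 := by
    refine Finset.card_le_one.mpr fun p hp q hq => ?_
    rw [Finset.mem_filter] at hp hq
    obtain ⟨hp1, hp2, hp3⟩ := hS' p hp.1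
    obtain ⟨hq1, hq2, hq3⟩ := hS' q hq.1
    by_contra hpq
    have h1 := gap_principle hp1.isCoprime hq1.isCoprime (by omega) (by omega) hpq hp3 hq3
    have h2 := hab p.2 q.2 hp2 hp.2 hq2 hq.2
    linarith
  have hlarge : ((S.filter fun p => nearest α p = i).filter fun p => ¬ p.2 < b).card ≤ 8 := by
    refine card_large_le h.isRootSystem le_rfl (h.mahler_le.trans hM) i hκ (by linarith) _
      (fun p hp => ?_) (fun p hp => ?_) (fun p hp => ?_) (fun p hp => ?_) <;>
      rw [Finset.mem_filter] at hp <;> obtain ⟨hp1, hp2, hp3⟩ := hS' p hp.1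
    · exact hp1.isCoprime
    · omega
    · exact hp3
    · refine hb.trans ?_
      have h1 : (b : ℝ) ≤ p.2 := by exact_mod_cast not_lt.mp hp.2
      have h2 : (0 : ℝ) ≤ b := by exact_mod_cast hb0
      gcongr
  omega

theorem prod_le_prod_of_subset_of_one_le_real {ι : Type*} [DecidableEq ι] {s t : Finset ι}
    {w : ι → ℝ} (hst : s ⊆ t) (hw : ∀ p, 1 ≤ w p) : ∏ p ∈ s, w p ≤ ∏ p ∈ t, w p := by
  rw [← Finset.prod_sdiff hst]
  exact le_mul_of_one_le_left (Finset.prod_nonneg fun p _ => zero_le_one.trans (hw p))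
    (Finset.prod_induction _ (fun x : ℝ => 1 ≤ x) (fun a b => one_le_mul_of_one_le_of_one_le) le_rfl
      fun p _ => hw p)

/-- Small solutions when the Mahler measure is large. -/
theorem IsReduced.card_small_le {f : ℤ[X]} {α : Fin 4 → ℂ} {M : ℝ} (h : IsReduced f α M)
    (hM : 32 ≤ M) (S : Finset (ℤ × ℤ))
    (hS : ∀ p ∈ S, IsSol f p ∧ 0 < p.2 ∧ (p.2 : ℝ) ^ 2 < (M / 16) ^ 5) : S.card ≤ 13 := by
  classical
  by_contra hcard
  push Not at hcard
  set G := M / 16 with hG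
  have hG2 : 2 ≤ G := by rw [hG]; linarith
  have hweight : ∀ p ∈ S, G ≤ ∏ i, weight (α i) p := by
    intro p hp
    have := h.le_prod_weight (hS p hp).1 (hS p hp).2.1
    rw [hG]; linarith
  set A : Fin 4 → Finset (ℤ × ℤ) := fun i => S.filter fun p => (p.2 : ℝ) * ‖linForm (α i) p‖ ≤ 1 / 2
    with hA
  have hA' : ∀ i, ∀ p ∈ A i, p ∈ S ∧ (p.2 : ℝ) * ‖linForm (α i) p‖ ≤ 1 / 2 := fun i p hp =>
    Finset.mem_filter.mp hp
  have hex : ∀ i, ∃ m, (∏ p ∈ (A i).erase m, weight (α i) p) ^ 2 < G ^ 5 := by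
    intro i
    rcases (A i).eq_empty_or_nonempty with h0 | h0
    · refine ⟨0, ?_⟩
      rw [h0, Finset.erase_empty, Finset.prod_empty, one_pow]
      exact lt_of_lt_of_le (by norm_num) (pow_le_pow_left₀ (by norm_num) hG2 5)
    · obtain ⟨m, hm, -, hprod⟩ := exists_max_prod_erase_le (y := fun p : ℤ × ℤ => (p.2 : ℝ))
        (w := weight (α i)) (A i) h0
        (fun p hp => by exact_mod_cast (hS p (hA' i p hp).1).2.1)
        (fun p _ => zero_le_one.trans (one_le_weight _ _)) (by
          intro p hp q hq hpq hle
          obtain ⟨hpS, hpu⟩ := hA' i p hp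
          obtain ⟨hqS, hqu⟩ := hA' i q hq
          obtain ⟨hp1, hp2, -⟩ := hS p hpS
          obtain ⟨hq1, hq2, -⟩ := hS q hqS
          have hyp : (0 : ℝ) < p.2 := by exact_mod_cast hp2
          have hyq : (0 : ℝ) < q.2 := by exact_mod_cast hq2
          have h1 := one_le_of_ne (a := α i) hp1.isCoprime hq1.isCoprime hp2 hq2 hpq
          have h2 : ‖linForm (α i) q‖ * p.2 ≤ q.2 * ‖linForm (α i) q‖ := by
            rw [mul_comm]; gcongr
          have h3 : 1 / 2 ≤ ‖linForm (α i) p‖ * q.2 := by linarith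
          have h4 : 0 < ‖linForm (α i) p‖ := by
            by_contra h0
            have : ‖linForm (α i) p‖ * q.2 ≤ 0 :=
              mul_nonpos_of_nonpos_of_nonneg (not_lt.mp h0) hyq.le
            linarith
          simp only [weight]
          rw [mul_max_of_nonneg _ _ hyp.le, mul_one]
          refine max_le hle ?_
          rw [mul_one_div, div_le_iff₀ (by positivity)]
          nlinarith)
      refine ⟨m, lt_of_le_of_lt ?_ (hS m (hA' i m hm).1).2.2⟩
      exact pow_le_pow_left₀ (Finset.prod_nonneg fun p _ => zero_le_one.trans (one_le_weight _ _))
        hprod 2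
  choose m hm using hex
  set R := S \ Finset.univ.image m with hR
  have hRcard : 10 ≤ R.card := by
    have h1 : S.card - (Finset.univ.image m).card ≤ R.card := Finset.le_card_sdiff _ _
    have h2 : (Finset.univ.image m).card ≤ 4 := Finset.card_image_le.trans (by simp)
    omega
  have hlow : G ^ 10 ≤ ∏ i, ∏ p ∈ R, weight (α i) p := by
    rw [Finset.prod_comm]
    calc G ^ 10 ≤ G ^ R.card := pow_le_pow_right₀ (by linarith) hRcard
      _ = ∏ p ∈ R, G := by rw [Finset.prod_const]
      _ ≤ _ := Finset.prod_le_prod (fun _ _ => by linarith) fun p hp =>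
          hweight p (Finset.mem_sdiff.mp hp).1
  have hup : ∀ i, ∏ p ∈ R, weight (α i) p ≤ ∏ p ∈ (A i).erase (m i), weight (α i) p := by
    intro i
    have h1 : ∏ p ∈ R, weight (α i) p = ∏ p ∈ R.filter (· ∈ A i), weight (α i) p := by
      rw [Finset.prod_filter]
      refine Finset.prod_congr rfl fun p hp => ?_
      split_ifs with hpA
      · rfl
      · refine weight_eq_one ?_
        by_contra hcon
        exact hpA (Finset.mem_filter.mpr ⟨(Finset.mem_sdiff.mp hp).1, (not_le.mp hcon).le⟩)
    rw [h1]
    refine prod_le_prod_of_subset_of_one_le_real (fun p hp => ?_) fun p => one_le_weight _ _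
    obtain ⟨hpR, hpA⟩ := Finset.mem_filter.mp hp
    refine Finset.mem_erase.mpr ⟨fun h0 => ?_, hpA⟩
    exact (Finset.mem_sdiff.mp hpR).2 (Finset.mem_image.mpr ⟨i, Finset.mem_univ i, h0.symm⟩)
  have h1 : (G ^ 10) ^ 2 ≤ ∏ i, (∏ p ∈ (A i).erase (m i), weight (α i) p) ^ 2 := by
    rw [Finset.prod_pow]
    refine pow_le_pow_left₀ (by positivity) (hlow.trans ?_) 2
    exact Finset.prod_le_prod (fun i _ => Finset.prod_nonneg fun p _ =>
      zero_le_one.trans (one_le_weight _ _)) fun i _ => hup i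
  have h2 : ∏ i, (∏ p ∈ (A i).erase (m i), weight (α i) p) ^ 2 < ∏ i : Fin 4, G ^ 5 :=
    Finset.prod_lt_prod_of_nonempty (fun i _ => pow_pos (Finset.prod_pos fun p _ =>
      zero_lt_one.trans_le (one_le_weight _ _)) 2) (fun i _ => hm i) Finset.univ_nonempty
  rw [Finset.prod_const, Finset.card_univ, Fintype.card_fin] at h2
  have h3 : (G ^ 10) ^ 2 = (G ^ 5) ^ 4 := by ring
  linarith

theorem IsReduced.card_large_le {f : ℤ[X]} {α : Fin 4 → ℂ} {M : ℝ} (h : IsReduced f α M)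
    (hM : 32 ≤ M) (S : Finset (ℤ × ℤ))
    (hS : ∀ p ∈ S, IsSol f p ∧ 0 < p.2 ∧ (M / 16) ^ 5 ≤ (p.2 : ℝ) ^ 2) : S.card ≤ 4 * 8 := by
  refine card_le_of_forall_nearest α S 8 fun i => ?_
  have hM0 : 0 < M := by linarith
  refine QuarticThue.card_large_le h.isRootSystem hM h.mahler_le i (κ := 64 * M ^ 2 / 15625) (by
    nlinarith) (by nlinarith) _ (fun p hp => ?_) (fun p hp => ?_) (fun p hp => ?_)
    (fun p hp => ?_) <;> rw [Finset.mem_filter] at hp <;> obtain ⟨hp1, hp2, hp3⟩ := hS p hp.1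
  · exact hp1.isCoprime
  · exact hp2
  · exact h.isRootSystem.norm_linForm_le h.mahler_le h.le_vdm hp1 hp2
      (hp.2 ▸ isNearest_nearest α p)
  · have h1 : 23 / 100000 * M ^ 3 ≤ 99 / 100 * (p.2 : ℝ) ^ 2 / (64 * M ^ 2 / 15625) := by
      rw [le_div_iff₀ (by positivity)]
      have : (M / 16) ^ 5 = M ^ 5 / 1048576 := by ring
      nlinarith [pow_pos hM0 5]
    refine le_trans ?_ (pow_le_pow_left₀ (by positivity) h1 243)
    have h2 : (23 / 100000 * M ^ 3) ^ 243 = M ^ 140 * ((23 / 100000) ^ 243 * M ^ 589) := by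
      rw [mul_pow, ← pow_mul]
      rw [show 3 * 243 = 140 + 589 by norm_num, pow_add]; ring
    rw [h2]
    refine le_mul_of_one_le_right (by positivity) ?_
    have h3 : (1 : ℝ) ≤ (23 / 100000) ^ 243 * 32 ^ 589 := by
      rw [show (32 : ℝ) ^ 589 = (32 ^ 196) ^ 3 * 32 by rw [← pow_mul, ← pow_succ]]
      norm_num
    exact h3.trans (by gcongr)

theorem IsReduced.card_le {f : ℤ[X]} {α : Fin 4 → ℂ} {M : ℝ} (h : IsReduced f α M)
    (S : Finset (ℤ × ℤ)) (hS : ∀ p ∈ S, IsSol f p ∧ 0 < p.2) : S.card ≤ 45 := by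
  rcases le_total 32 M with hM | hM
  · have h1 := h.card_small_le hM (S.filter fun p => (p.2 : ℝ) ^ 2 < (M / 16) ^ 5) fun p hp => by
      rw [Finset.mem_filter] at hp
      exact ⟨(hS p hp.1).1, (hS p hp.1).2, hp.2⟩
    have h2 := h.card_large_le hM (S.filter fun p => ¬ (p.2 : ℝ) ^ 2 < (M / 16) ^ 5) fun p hp => by
      rw [Finset.mem_filter] at hp
      exact ⟨(hS p hp.1).1, (hS p hp.1).2, not_lt.mp hp.2⟩
    rw [← Finset.card_filter_add_card_filter_not (fun p : ℤ × ℤ => (p.2 : ℝ) ^ 2 < (M / 16) ^ 5)]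
    omega
  · have hM0 : 0 ≤ M := zero_le_one.trans ((Finset.prod_induction _ (fun x : ℝ => 1 ≤ x)
      (fun a b => one_le_mul_of_one_le_of_one_le) le_rfl fun i _ => le_max_left _ _).trans
      h.mahler_le)
    rw [← Finset.card_filter_add_card_filter_not (fun p : ℤ × ℤ => p.2 = 1)]
    rcases le_or_gt M 20 with hM20 | hM20
    · have h1 := card_le_eight_of_snd_eq_one h.isRootSystem.natDegree_eq
        (S.filter fun p => p.2 = 1) fun p hp => by
          rw [Finset.mem_filter] at hp
          exact ⟨(hS p hp.1).1, hp.2⟩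
      have h2 := h.card_le_nine (κ := 64 * 20 ^ 2 / 15625) (a := 2) (b := 5) (by norm_num)
        (by norm_num) (by gcongr) hM (by norm_num) (by norm_num)
        (fun y z _ _ _ _ => by interval_cases y <;> interval_cases z <;> norm_num) (by norm_num)
        (S.filter fun p => ¬ p.2 = 1) fun p hp => by
          rw [Finset.mem_filter] at hp
          have := (hS p hp.1).2
          exact ⟨(hS p hp.1).1, by omega⟩
      omega
    · have h1 := h.card_le_four hM20 one_pos (S.filter fun p => p.2 = 1) fun p hp => by
        rw [Finset.mem_filter] at hp
        exact ⟨(hS p hp.1).1, hp.2⟩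
      rw [← Finset.card_filter_add_card_filter_not (s := S.filter fun p => ¬ p.2 = 1)
        (fun p : ℤ × ℤ => p.2 = 2)]
      have h2 := h.card_le_four hM20 two_pos ((S.filter fun p => ¬ p.2 = 1).filter fun p => p.2 = 2)
        fun p hp => by
          rw [Finset.mem_filter, Finset.mem_filter] at hp
          exact ⟨(hS p hp.1.1).1, hp.2⟩
      have h3 := h.card_le_nine (κ := 64 * 32 ^ 2 / 15625) (a := 3) (b := 7) (by norm_num)
        (by norm_num) (by gcongr) hM (by norm_num) (by norm_num)
        (fun y z _ _ _ _ => by interval_cases y <;> interval_cases z <;> norm_num) (by norm_num)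
        ((S.filter fun p => ¬ p.2 = 1).filter fun p => ¬ p.2 = 2) fun p hp => by
          rw [Finset.mem_filter, Finset.mem_filter] at hp
          have := (hS p hp.1.1).2
          exact ⟨(hS p hp.1.1).1, by omega⟩
      omega

/-- The integral combination of `a` and `b` with coefficients `v`. -/
def comb (a b v : ℤ × ℤ) : ℤ × ℤ := (v.1 * a.1 + v.2 * b.1, v.1 * a.2 + v.2 * b.2)

/-- The determinant of a pair of integer vectors. -/
def det (a b : ℤ × ℤ) : ℤ := a.1 * b.2 - b.1 * a.2

theorem comb_comb (a b w z q : ℤ × ℤ) :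
    comb (comb a b w) (comb a b z) q = comb a b (comb w z q) := by
  simp only [comb, Prod.mk.injEq]; constructor <;> ring

theorem det_comb (a b w z : ℤ × ℤ) : det (comb a b w) (comb a b z) = det a b * det w z := by
  simp only [comb, det]; ring

theorem linForm_comb (γ : ℂ) (a b v : ℤ × ℤ) :
    linForm γ (comb a b v) = v.1 * linForm γ a + v.2 * linForm γ b := by
  simp only [comb, linForm]; push_cast; ring

/-- The roots of the form transported to the basis `n, m`. -/
noncomputable def transRoot (γ : Fin 4 → ℂ) (n m : ℤ × ℤ) (i : Fin 4) : ℂ :=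
  -(linForm (γ i) m / linForm (γ i) n)

/-- The dehomogenization of the form transported to the basis `n, m`. -/
noncomputable def transPoly (f : ℤ[X]) (n m : ℤ × ℤ) : ℤ[X] :=
  C (formVal f n) * ∑ i ∈ Finset.range 5,
    C (f.coeff i) * (C n.1 * X + C m.1) ^ i * (C n.2 * X + C m.2) ^ (4 - i)

theorem natDegree_minpoly_le_of_mem_adjoin {K L : Type*} [Field K] [Field L] [Algebra K L]
    {x y : L} (hy : IsIntegral K y) (hx : x ∈ IntermediateField.adjoin K {y}) :
    (minpoly K x).natDegree ≤ (minpoly K y).natDegree := by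
  have hfin : FiniteDimensional K (IntermediateField.adjoin K {y}) :=
    IntermediateField.adjoin.finiteDimensional hy
  rw [← IntermediateField.adjoin.finrank hy]
  have h1 := minpoly.natDegree_le (A := K) (⟨x, hx⟩ : IntermediateField.adjoin K {y})
  rwa [IntermediateField.minpoly_eq] at h1

namespace IsRootSystem

variable {f : ℤ[X]} {γ : Fin 4 → ℂ}

theorem coeff_eq (h : IsRootSystem f γ) :
    (f.coeff 0 : ℂ) = γ 0 * γ 1 * γ 2 * γ 3 ∧
    (f.coeff 1 : ℂ) = -(γ 0 * γ 1 * γ 2 + γ 0 * γ 1 * γ 3 + γ 0 * γ 2 * γ 3 + γ 1 * γ 2 * γ 3) ∧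
    (f.coeff 2 : ℂ) = γ 0 * γ 1 + γ 0 * γ 2 + γ 0 * γ 3 + γ 1 * γ 2 + γ 1 * γ 3 + γ 2 * γ 3 ∧
    (f.coeff 3 : ℂ) = -(γ 0 + γ 1 + γ 2 + γ 3) ∧ (f.coeff 4 : ℂ) = 1 := by
  have h1 : f.map (Int.castRingHom ℂ) = X ^ 4 + C (-(γ 0 + γ 1 + γ 2 + γ 3)) * X ^ 3 +
      C (γ 0 * γ 1 + γ 0 * γ 2 + γ 0 * γ 3 + γ 1 * γ 2 + γ 1 * γ 3 + γ 2 * γ 3) * X ^ 2 +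
      C (-(γ 0 * γ 1 * γ 2 + γ 0 * γ 1 * γ 3 + γ 0 * γ 2 * γ 3 + γ 1 * γ 2 * γ 3)) * X +
      C (γ 0 * γ 1 * γ 2 * γ 3) := by
    rw [h.map_eq, Fin.prod_univ_four]
    simp only [map_add, map_mul, map_neg]; ring
  have h2 (i : ℕ) : (f.coeff i : ℂ) = (f.map (Int.castRingHom ℂ)).coeff i := by
    rw [coeff_map]; rfl
  simp only [h2, h1]
  refine ⟨?_, ?_, ?_, ?_, ?_⟩ <;>
    simp only [coeff_add, coeff_C_mul, coeff_X_pow, coeff_X, coeff_C] <;> norm_num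

theorem sum_coeff_eq_prod (h : IsRootSystem f γ) (U V : ℂ[X]) :
    ∑ i ∈ Finset.range 5, C (f.coeff i : ℂ) * U ^ i * V ^ (4 - i) =
      ∏ i, (U - C (γ i) * V) := by
  obtain ⟨h0, h1, h2, h3, h4⟩ := h.coeff_eq
  simp only [Finset.sum_range_succ, Finset.sum_range_zero, Fin.prod_univ_four, h0, h1, h2, h3, h4,
    map_add, map_mul, map_neg, map_one]
  ring

theorem linForm_ne_zero (h : IsRootSystem f γ) {n : ℤ × ℤ} (hn : IsSol f n) (i : Fin 4) :
    linForm (γ i) n ≠ 0 := by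
  intro h0
  have h1 := h.prod_norm_linForm hn
  rw [Finset.prod_eq_zero (Finset.mem_univ i) (by simp [h0])] at h1
  exact zero_ne_one h1

theorem map_transPoly (h : IsRootSystem f γ) {n : ℤ × ℤ} (hn : IsSol f n) (m : ℤ × ℤ) :
    (transPoly f n m).map (Int.castRingHom ℂ) = ∏ i, (X - C (transRoot γ n m i)) := by
  have h1 := h.sum_coeff_eq_prod (C (n.1 : ℂ) * X + C (m.1 : ℂ)) (C (n.2 : ℂ) * X + C (m.2 : ℂ))
  have h2 : (transPoly f n m).map (Int.castRingHom ℂ) = C (formVal f n : ℂ) *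
      ∑ i ∈ Finset.range 5, C (f.coeff i : ℂ) * (C (n.1 : ℂ) * X + C (m.1 : ℂ)) ^ i *
        (C (n.2 : ℂ) * X + C (m.2 : ℂ)) ^ (4 - i) := by
    simp [transPoly, Polynomial.map_sum]
  have h3 (i : Fin 4) : (C (n.1 : ℂ) * X + C (m.1 : ℂ)) - C (γ i) * (C (n.2 : ℂ) * X + C (m.2 : ℂ)) =
      C (linForm (γ i) n) * (X - C (transRoot γ n m i)) := by
    have h4 : linForm (γ i) n * transRoot γ n m i = -linForm (γ i) m := by
      have := h.linForm_ne_zero hn i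
      rw [transRoot]; field_simp
    rw [mul_sub, ← C_mul, h4]
    simp only [linForm, map_sub, map_mul, map_neg]; ring
  rw [h2, h1, Finset.prod_congr rfl fun i _ => h3 i, Finset.prod_mul_distrib, ← mul_assoc]
  have h5 : ∏ i, C (linForm (γ i) n) = C (formVal f n : ℂ) := by
    rw [h.formVal_eq n, map_prod]
  rw [h5, ← C_mul]
  have h6 : (formVal f n : ℂ) * formVal f n = 1 := by
    rcases hn with hn | hn <;> simp [hn]
  rw [h6, C_1, one_mul]

theorem trans (h : IsRootSystem f γ) {n m : ℤ × ℤ} (hn : IsSol f n) (hd : det n m ≠ 0) :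
    IsRootSystem (transPoly f n m) (transRoot γ n m) := by
  refine ⟨h.map_transPoly hn m, ?_⟩
  set g := transPoly f n m with hg
  set β := transRoot γ n m 0 with hβ
  have hmap := h.map_transPoly hn m
  have hmonic : g.Monic := by
    have : (g.map (Int.castRingHom ℂ)).Monic := by
      rw [hmap]; exact monic_prod_of_monic _ _ fun i _ => monic_X_sub_C _
    exact monic_of_injective (Int.castRingHom ℂ).injective_int this
  have hdeg : g.natDegree = 4 := by
    have := congrArg natDegree hmap
    rw [natDegree_map_eq_of_injective (Int.castRingHom ℂ).injective_int,
      natDegree_prod_of_monic _ _ fun i _ => monic_X_sub_C _] at this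
    simpa using this
  have hroot : aeval β (g.map (Int.castRingHom ℚ)) = 0 := by
    have h1 : aeval β (g.map (algebraMap ℤ ℚ)) = (g.map (Int.castRingHom ℂ)).eval β := by
      rw [aeval_map_algebraMap, aeval_def, eval_map]; rfl
    change aeval β (g.map (algebraMap ℤ ℚ)) = 0
    rw [h1, hmap, eval_prod]
    exact Finset.prod_eq_zero (Finset.mem_univ 0) (by simp [hβ])
  have hmonic' : (g.map (Int.castRingHom ℚ)).Monic := hmonic.map _
  have hinteg : IsIntegral ℚ β := ⟨_, hmonic', by simpa [aeval_def] using hroot⟩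
  have hγ : minpoly ℚ (γ 0) = f.map (Int.castRingHom ℚ) :=
    (minpoly.eq_of_irreducible_of_monic h.irreducible
      (by change aeval (γ 0) (f.map (algebraMap ℤ ℚ)) = 0
          rw [aeval_map_algebraMap]; exact h.aeval_root 0) (h.monic.map _)).symm
  have hmem : γ 0 ∈ IntermediateField.adjoin ℚ {β} := by
    have hℓ := h.linForm_ne_zero hn 0
    have h1 : γ 0 * (m.2 + β * n.2) = m.1 + β * n.1 := by
      have : β * linForm (γ 0) n = -linForm (γ 0) m := by
        rw [hβ, transRoot]; field_simp
      simp only [linForm] at this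
      linear_combination -this
    have h2 : (m.2 + β * n.2 : ℂ) ≠ 0 := by
      intro h0
      rw [h0, mul_zero] at h1
      apply hd
      have : (det n m : ℂ) = 0 := by
        rw [det]; push_cast; linear_combination (n.1 : ℂ) * h0 + (n.2 : ℂ) * h1
      exact_mod_cast this
    rw [eq_div_of_mul_eq h2 h1]
    have hb := IntermediateField.mem_adjoin_simple_self ℚ β
    have hz (k : ℤ) : (k : ℂ) ∈ IntermediateField.adjoin ℚ {β} := intCast_mem _ k
    exact div_mem (add_mem (hz _) (mul_mem hb (hz _))) (add_mem (hz _) (mul_mem hb (hz _)))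
  have h4 : 4 ≤ (minpoly ℚ β).natDegree := by
    have h1 := natDegree_minpoly_le_of_mem_adjoin hinteg hmem
    rwa [hγ, h.monic.natDegree_map, h.natDegree_eq] at h1
  have h5 : g.map (Int.castRingHom ℚ) = minpoly ℚ β := by
    refine eq_of_monic_of_dvd_of_natDegree_le (minpoly.monic hinteg) hmonic'
      (minpoly.dvd _ _ hroot) ?_
    rw [hmonic.natDegree_map, hdeg]; exact h4
  rw [h5]
  exact minpoly.irreducible hinteg

theorem linForm_transRoot (h : IsRootSystem f γ) {n : ℤ × ℤ} (hn : IsSol f n) (m q : ℤ × ℤ)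
    (i : Fin 4) :
    linForm (transRoot γ n m i) q = linForm (γ i) (comb n m q) / linForm (γ i) n := by
  have := h.linForm_ne_zero hn i
  rw [linForm_comb]
  rw [linForm, transRoot]
  field_simp
  ring

theorem isSol_trans_iff (h : IsRootSystem f γ) {n m : ℤ × ℤ} (hn : IsSol f n)
    (hd : det n m ≠ 0) (q : ℤ × ℤ) :
    IsSol (transPoly f n m) q ↔ IsSol f (comb n m q) := by
  have h1 : (formVal (transPoly f n m) q : ℂ) * formVal f n = formVal f (comb n m q) := by
    rw [(h.trans hn hd).formVal_eq, h.formVal_eq, h.formVal_eq, ← Finset.prod_mul_distrib]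
    refine Finset.prod_congr rfl fun i _ => ?_
    rw [h.linForm_transRoot hn, div_mul_cancel₀ _ (h.linForm_ne_zero hn i)]
  have h2 : formVal (transPoly f n m) q * formVal f n = formVal f (comb n m q) := by
    exact_mod_cast h1
  rw [IsSol, IsSol]
  rcases hn with hn | hn <;> rw [hn] at h2 <;> omega

theorem norm_transRoot_sub (h : IsRootSystem f γ) {n : ℤ × ℤ} (hn : IsSol f n) (m : ℤ × ℤ)
    (i j : Fin 4) :
    ‖transRoot γ n m i - transRoot γ n m j‖ * (‖linForm (γ i) n‖ * ‖linForm (γ j) n‖) =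
      |(det n m : ℝ)| * ‖γ i - γ j‖ := by
  have hi := h.linForm_ne_zero hn i
  have hj := h.linForm_ne_zero hn j
  have h1 : (transRoot γ n m i - transRoot γ n m j) * (linForm (γ i) n * linForm (γ j) n) =
      -(det n m) * (γ j - γ i) := by
    rw [transRoot, transRoot]
    field_simp
    simp only [linForm, det]; push_cast; ring
  have h2 := congrArg norm h1
  rw [norm_mul, norm_mul, norm_mul, norm_neg, Complex.norm_intCast, norm_sub_rev (γ j)] at h2
  exact h2

theorem vdm_transRoot (h : IsRootSystem f γ) {n : ℤ × ℤ} (hn : IsSol f n) (m : ℤ × ℤ) :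
    vdm (transRoot γ n m) = |(det n m : ℝ)| ^ 6 * vdm γ := by
  have h1 := h.prod_norm_linForm hn
  rw [Fin.prod_univ_four] at h1
  have g := h.norm_transRoot_sub hn m
  calc vdm (transRoot γ n m) = vdm (transRoot γ n m) * (‖linForm (γ 0) n‖ * ‖linForm (γ 1) n‖ *
        ‖linForm (γ 2) n‖ * ‖linForm (γ 3) n‖) ^ 3 := by rw [h1]; ring
    _ = (|(det n m : ℝ)| * ‖γ 0 - γ 1‖) * (|(det n m : ℝ)| * ‖γ 0 - γ 2‖) *
        (|(det n m : ℝ)| * ‖γ 0 - γ 3‖) * (|(det n m : ℝ)| * ‖γ 1 - γ 2‖) *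
        (|(det n m : ℝ)| * ‖γ 1 - γ 3‖) * (|(det n m : ℝ)| * ‖γ 2 - γ 3‖) := by
      rw [← g 0 1, ← g 0 2, ← g 0 3, ← g 1 2, ← g 1 3, ← g 2 3, vdm]; ring
    _ = _ := by rw [vdm]; ring

theorem one_le_vdm (h : IsRootSystem f γ) : 1 ≤ vdm γ := by
  have hd (i : Fin 4) : aeval (γ i) (derivative f) =
      (derivative ((X - C (γ 0)) * (X - C (γ 1)) * (X - C (γ 2)) * (X - C (γ 3)))).eval (γ i) := by
    rw [← Fin.prod_univ_four (fun i => X - C (γ i)), ← h.map_eq, derivative_map, aeval_def,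
      eval_map]
    rfl
  have h0 : aeval (γ 0) (derivative f) = (γ 0 - γ 1) * (γ 0 - γ 2) * (γ 0 - γ 3) := by
    rw [hd]; simp [derivative_mul]
  have h1 : aeval (γ 1) (derivative f) = (γ 1 - γ 0) * (γ 1 - γ 2) * (γ 1 - γ 3) := by
    rw [hd]; simp [derivative_mul]
  have h2 : aeval (γ 2) (derivative f) = (γ 2 - γ 0) * (γ 2 - γ 1) * (γ 2 - γ 3) := by
    rw [hd]; simp [derivative_mul]
  have h3 : aeval (γ 3) (derivative f) = (γ 3 - γ 0) * (γ 3 - γ 1) * (γ 3 - γ 2) := by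
    rw [hd]; simp [derivative_mul]
  have hne : aeval (γ 0) (derivative f) ≠ 0 := by
    rw [h0]
    have g (j : Fin 4) (hj : 0 ≠ j) : γ 0 - γ j ≠ 0 := sub_ne_zero.mpr (h.injective.ne hj)
    exact mul_ne_zero (mul_ne_zero (g 1 (by decide)) (g 2 (by decide))) (g 3 (by decide))
  have h4 := h.one_le_prod_norm hne
  have h5 : ∏ j, ‖aeval (γ j) (derivative f)‖ = vdm γ ^ 2 := by
    rw [Fin.prod_univ_four, h0, h1, h2, h3, vdm]
    simp only [norm_mul]
    rw [norm_sub_rev (γ 1) (γ 0), norm_sub_rev (γ 2) (γ 0), norm_sub_rev (γ 2) (γ 1),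
      norm_sub_rev (γ 3) (γ 0), norm_sub_rev (γ 3) (γ 1), norm_sub_rev (γ 3) (γ 2)]
    ring
  rw [h5] at h4
  have h6 : 0 ≤ vdm γ := by rw [vdm]; positivity
  nlinarith

end IsRootSystem

theorem formVal_neg (f : ℤ[X]) (p : ℤ × ℤ) : formVal f (-p) = formVal f p := by
  simp only [formVal, Finset.sum_range_succ, Finset.sum_range_zero, Prod.fst_neg, Prod.snd_neg]
  ring

theorem IsSol.neg {f : ℤ[X]} {p : ℤ × ℤ} (hp : IsSol f p) : IsSol f (-p) := by
  rwa [IsSol, formVal_neg]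

theorem comb_neg (a b v : ℤ × ℤ) : comb a b (-v) = -comb a b v := by
  ext <;> simp only [comb, Prod.fst_neg, Prod.snd_neg] <;> ring

theorem comb_coords {w z : ℤ × ℤ} (h : det w z = 1) (v : ℤ × ℤ) :
    comb w z (det v z, det w v) = v := by
  simp only [det] at h
  ext <;> simp only [comb, det]
  · linear_combination v.1 * h
  · linear_combination v.2 * h

theorem exists_det_eq_one {v : ℤ × ℤ} (hv : IsCoprime v.1 v.2) : ∃ z, det v z = 1 := by
  obtain ⟨x, y, h⟩ := hv
  exact ⟨(-y, x), by simp only [det]; linear_combination h⟩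

theorem isCoprime_of_comb {a b v : ℤ × ℤ} (h : IsCoprime (comb a b v).1 (comb a b v).2) :
    IsCoprime v.1 v.2 := by
  obtain ⟨x, y, h⟩ := h
  refine ⟨x * a.1 + y * a.2, x * b.1 + y * b.2, ?_⟩
  simp only [comb] at h
  linear_combination h

theorem IsSol.eq_or_eq_of_snd_eq_zero {f : ℤ[X]} {q : ℤ × ℤ} (hq : IsSol f q) (h0 : q.2 = 0) :
    q = (1, 0) ∨ q = (-1, 0) := by
  have h := hq.isCoprime
  rw [h0, isCoprime_zero_right, Int.isUnit_iff] at h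
  rcases h with h | h
  · exact Or.inl (Prod.ext h h0)
  · exact Or.inr (Prod.ext h h0)

/-- Every solution is, up to sign, `(1, 0)` or has positive second coordinate. -/
theorem IsSol.exists_normalized {f : ℤ[X]} {q : ℤ × ℤ} (hq : IsSol f q) :
    ∃ r, (q = r ∨ q = -r) ∧ IsSol f r ∧ (0 < r.2 ∨ r = (1, 0)) := by
  rcases lt_trichotomy q.2 0 with h | h | h
  · exact ⟨-q, Or.inr (neg_neg q).symm, hq.neg, Or.inl (by simpa using h)⟩
  · rcases hq.eq_or_eq_of_snd_eq_zero h with h1 | h1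
    · exact ⟨q, Or.inl rfl, hq, Or.inr h1⟩
    · exact ⟨-q, Or.inr (neg_neg q).symm, hq.neg, Or.inr (by rw [h1]; rfl)⟩
  · exact ⟨q, Or.inl rfl, hq, Or.inl h⟩

theorem IsReduced.card_le_of_comb {f g : ℤ[X]} {β : Fin 4 → ℂ} {M : ℝ} (h : IsReduced g β M)
    {n m : ℤ × ℤ} (hg : ∀ q, IsSol f (comb n m q) → IsSol g q) (T : Finset (ℤ × ℤ))
    (hT : ∀ p ∈ T, IsSol f p ∧ ∃ q, comb n m q = p) (hneg : ∀ p ∈ T, -p ∉ T) :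
    T.card ≤ 46 := by
  classical
  have key (p : ℤ × ℤ) (hp : p ∈ T) : ∃ r, (p = comb n m r ∨ p = -comb n m r) ∧ IsSol g r ∧
      (0 < r.2 ∨ r = (1, 0)) := by
    obtain ⟨hs, q, rfl⟩ := hT p hp
    obtain ⟨r, hr, hr2⟩ := (hg q hs).exists_normalized
    refine ⟨r, ?_, hr2⟩
    rw [← comb_neg]
    exact hr.imp (fun h => by rw [h]) (fun h => by rw [h])
  choose! r hr hsol hpos using key
  have hinj : Set.InjOn r T := by
    intro p hp p' hp' hpp
    have hp : p ∈ T := hp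
    have hp' : p' ∈ T := hp'
    have h1 := hr p hp
    have h2 := hr p' hp'
    rw [hpp] at h1
    rcases h1 with h1 | h1 <;> rcases h2 with h2 | h2
    · exact h1.trans h2.symm
    · exact absurd hp' (by rw [h2, ← h1]; exact hneg p hp)
    · exact absurd hp (by rw [h1, ← h2]; exact hneg p' hp')
    · exact h1.trans h2.symm
  have h1 : ((T.image r).erase (1, 0)).card ≤ 45 := by
    refine h.card_le _ fun q hq => ?_
    obtain ⟨hne, hq⟩ := Finset.mem_erase.mp hq
    obtain ⟨p, hp, rfl⟩ := Finset.mem_image.mp hq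
    exact ⟨hsol p hp, (hpos p hp).resolve_right hne⟩
  have h2 := Finset.pred_card_le_card_erase (s := T.image r) (a := (1, 0))
  rw [Finset.card_image_of_injOn hinj] at h2
  omega

namespace IsRootSystem

variable {f : ℤ[X]} {γ : Fin 4 → ℂ}

/-- Among the bases of a sublattice starting with a solution, choose one whose transported form
has almost minimal Mahler measure. -/
theorem exists_isReduced (h : IsRootSystem f γ) {a b : ℤ × ℤ} (hab : |det a b| = 5) {v : ℤ × ℤ}
    (hv : IsSol f (comb a b v)) :
    ∃ w z, det w z = 1 ∧ IsSol f (comb a b w) ∧ ∃ M,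
      IsReduced (transPoly f (comb a b w) (comb a b z))
        (transRoot γ (comb a b w) (comb a b z)) M := by
  classical
  set μ : ℤ × ℤ → ℤ × ℤ → ℝ := fun w z => ∏ i, max 1 ‖transRoot γ (comb a b w) (comb a b z) i‖
    with hμ
  have hex : ∃ k : ℕ, ∃ w z, det w z = 1 ∧ IsSol f (comb a b w) ∧ ⌊100 * μ w z⌋₊ = k := by
    obtain ⟨z, hz⟩ := exists_det_eq_one (isCoprime_of_comb hv.isCoprime)
    exact ⟨_, v, z, hz, hv, rfl⟩
  obtain ⟨w, z, hwz, hw, hk⟩ := Nat.find_spec hex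
  have hdet : |det (comb a b w) (comb a b z)| = 5 := by rw [det_comb, hwz, mul_one, hab]
  have hdet0 : det (comb a b w) (comb a b z) ≠ 0 := by
    intro h0; rw [h0] at hdet; norm_num at hdet
  refine ⟨w, z, hwz, hw, μ w z, h.trans hw hdet0, le_rfl, ?_, ?_⟩
  · rw [h.vdm_transRoot hw, ← Int.cast_abs, hdet]
    have := h.one_le_vdm
    norm_num
    linarith
  · intro p q hp hpq
    rw [h.isSol_trans_iff hw hdet0, comb_comb] at hp
    have hd : det (comb w z p) (comb w z q) = 1 := by
      rw [det_comb, hwz, one_mul]; exact hpq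
    have hmin := Nat.find_min' hex ⟨_, _, hd, hp, rfl⟩
    rw [← hk] at hmin
    have heq : μ (comb w z p) (comb w z q) =
        ∏ i, max 1 ‖linForm (transRoot γ (comb a b w) (comb a b z) i) q /
          linForm (transRoot γ (comb a b w) (comb a b z) i) p‖ := by
      refine Finset.prod_congr rfl fun i _ => ?_
      rw [h.linForm_transRoot hw, h.linForm_transRoot hw,
        div_div_div_cancel_right₀ (h.linForm_ne_zero hw i), transRoot, norm_neg, comb_comb,
        comb_comb]
    rw [← heq]
    have h1 := Nat.lt_floor_add_one (100 * μ w z)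
    have h2 : 0 ≤ μ (comb w z p) (comb w z q) := Finset.prod_nonneg fun i _ => by positivity
    have h3 := Nat.floor_le (mul_nonneg (by norm_num : (0 : ℝ) ≤ 100) h2)
    have h4 : (⌊100 * μ w z⌋₊ : ℝ) ≤ ⌊100 * μ (comb w z p) (comb w z q)⌋₊ := by
      exact_mod_cast hmin
    linarith

theorem card_le_of_sublattice (h : IsRootSystem f γ) {a b : ℤ × ℤ} (hab : |det a b| = 5)
    (T : Finset (ℤ × ℤ)) (hT : ∀ p ∈ T, IsSol f p ∧ ∃ v, comb a b v = p)
    (hneg : ∀ p ∈ T, -p ∉ T) : T.card ≤ 46 := by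
  rcases T.eq_empty_or_nonempty with rfl | ⟨p, hp⟩
  · simp
  obtain ⟨hps, v, rfl⟩ := hT p hp
  obtain ⟨w, z, hwz, hw, M, hM⟩ := h.exists_isReduced hab hps
  have hdet0 : det (comb a b w) (comb a b z) ≠ 0 := by
    rw [det_comb, hwz, mul_one]; intro h0; rw [h0] at hab; norm_num at hab
  refine hM.card_le_of_comb (fun q hq => (h.isSol_trans_iff hw hdet0 q).mpr hq) T
    (fun p hp => ⟨(hT p hp).1, ?_⟩) hneg
  obtain ⟨u, rfl⟩ := (hT p hp).2
  exact ⟨(det u z, det w u), by rw [comb_comb, comb_coords hwz]⟩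

end IsRootSystem

/-- The six sublattices of index five cover `ℤ²`. -/
theorem exists_sublattice_five (p : ℤ × ℤ) : ∃ i : Fin 6,
    ∃ v, comb (if i = 5 then (1, 0) else (5, 0)) (if i = 5 then (0, 5) else ((i : ℤ), 1)) v = p := by
  by_cases h : 5 ∣ p.2
  · obtain ⟨k, hk⟩ := h
    refine ⟨5, (p.1, k), ?_⟩
    ext <;> simp [comb, hk, mul_comm]
  · have key : ∃ i : Fin 6, i ≠ 5 ∧ (5 : ℤ) ∣ p.1 - i * p.2 := by
      have h1 : p.2 % 5 = 1 ∨ p.2 % 5 = 2 ∨ p.2 % 5 = 3 ∨ p.2 % 5 = 4 := by omega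
      have h2 : (5 : ℤ) ∣ p.1 ∨ (5 : ℤ) ∣ p.1 - p.2 ∨ (5 : ℤ) ∣ p.1 - 2 * p.2 ∨
          (5 : ℤ) ∣ p.1 - 3 * p.2 ∨ (5 : ℤ) ∣ p.1 - 4 * p.2 := by omega
      rcases h2 with h2 | h2 | h2 | h2 | h2
      · exact ⟨0, by decide, by simpa using h2⟩
      · exact ⟨1, by decide, by simpa using h2⟩
      · exact ⟨2, by decide, by simpa using h2⟩
      · exact ⟨3, by decide, by simpa using h2⟩
      · exact ⟨4, by decide, by simpa using h2⟩
    obtain ⟨i, hi, k, hk⟩ := key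
    refine ⟨i, (k, p.2), ?_⟩
    rw [if_neg hi, if_neg hi]
    ext <;> simp only [comb]
    · linarith
    · ring

theorem IsRootSystem.card_le {f : ℤ[X]} {γ : Fin 4 → ℂ} (h : IsRootSystem f γ)
    (T : Finset (ℤ × ℤ)) (hT : ∀ p ∈ T, IsSol f p) (hneg : ∀ p ∈ T, -p ∉ T) :
    T.card ≤ 276 := by
  classical
  set A : Fin 6 → ℤ × ℤ := fun i => if i = 5 then (1, 0) else (5, 0) with hA
  set B : Fin 6 → ℤ × ℤ := fun i => if i = 5 then (0, 5) else ((i : ℤ), 1) with hB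
  set t : Fin 6 → Finset (ℤ × ℤ) := fun i => T.filter fun p => ∃ v, comb (A i) (B i) v = p with ht
  have hdet (i : Fin 6) : |det (A i) (B i)| = 5 := by
    simp only [hA, hB, det]; split_ifs <;> simp
  have h1 : T ⊆ Finset.univ.biUnion t := by
    intro p hp
    obtain ⟨i, hi⟩ := exists_sublattice_five p
    exact Finset.mem_biUnion.mpr ⟨i, Finset.mem_univ i, Finset.mem_filter.mpr ⟨hp, hi⟩⟩
  have h2 : (Finset.univ.biUnion t).card ≤ (Finset.univ : Finset (Fin 6)).card * 46 := by
    refine Finset.card_biUnion_le_card_mul _ _ _ fun i _ => ?_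
    refine h.card_le_of_sublattice (hdet i) (t i) (fun p hp => ?_) fun p hp hp' => ?_
    · exact ⟨hT p (Finset.mem_filter.mp hp).1, (Finset.mem_filter.mp hp).2⟩
    · exact hneg p (Finset.mem_filter.mp hp).1 (Finset.mem_filter.mp hp').1
  have h3 := (Finset.card_le_card h1).trans h2
  simpa using h3

/-- The monic quartic with the given lower coefficients. -/
noncomputable def monicQuartic {R : Type*} [CommRing R] (b c d e : R) : R[X] :=
  X ^ 4 + C b * X ^ 3 + C c * X ^ 2 + C d * X + C e

theorem natDegree_monicQuartic {R : Type*} [CommRing R] [Nontrivial R] (b c d e : R) :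
    (monicQuartic b c d e).natDegree = 4 := by
  rw [monicQuartic]; compute_degree!

theorem monic_monicQuartic {R : Type*} [CommRing R] (b c d e : R) :
    (monicQuartic b c d e).Monic := by
  rw [monicQuartic]; monicity!

theorem map_monicQuartic {R S : Type*} [CommRing R] [CommRing S] (φ : R →+* S) (b c d e : R) :
    (monicQuartic b c d e).map φ = monicQuartic (φ b) (φ c) (φ d) (φ e) := by
  simp [monicQuartic]

theorem formVal_monicQuartic (b c d e : ℤ) (q : ℤ × ℤ) :
    formVal (monicQuartic b c d e) q = q.1 ^ 4 + b * q.1 ^ 3 * q.2 + c * q.1 ^ 2 * q.2 ^ 2 +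
      d * q.1 * q.2 ^ 3 + e * q.2 ^ 4 := by
  have h0 : (monicQuartic b c d e).coeff 0 = e := by simp [monicQuartic]
  have h1 : (monicQuartic b c d e).coeff 1 = d := by
    simp only [monicQuartic, coeff_add, coeff_C_mul, coeff_X_pow, coeff_X, coeff_C]; norm_num
  have h2 : (monicQuartic b c d e).coeff 2 = c := by
    simp only [monicQuartic, coeff_add, coeff_C_mul, coeff_X_pow, coeff_X, coeff_C]; norm_num
  have h3 : (monicQuartic b c d e).coeff 3 = b := by
    simp only [monicQuartic, coeff_add, coeff_C_mul, coeff_X_pow, coeff_X, coeff_C]; norm_num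
  have h4 : (monicQuartic b c d e).coeff 4 = 1 := by
    simp only [monicQuartic, coeff_add, coeff_C_mul, coeff_X_pow, coeff_X, coeff_C]; norm_num
  simp only [formVal, Finset.sum_range_succ, Finset.sum_range_zero, h0, h1, h2, h3, h4]
  ring

theorem exists_isRootSystem {b c d e : ℤ}
    (h : Irreducible (monicQuartic (b : ℚ) (c : ℚ) (d : ℚ) (e : ℚ))) :
    ∃ γ, IsRootSystem (monicQuartic b c d e) γ := by
  have hs : ((monicQuartic b c d e).map (Int.castRingHom ℂ)).Splits := IsAlgClosed.splits _
  have hm : ((monicQuartic b c d e).map (Int.castRingHom ℂ)).Monic :=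
    (monic_monicQuartic b c d e).map _
  have hc : ((monicQuartic b c d e).map (Int.castRingHom ℂ)).roots.card = 4 := by
    rw [← hs.natDegree_eq_card_roots, map_monicQuartic, natDegree_monicQuartic]
  have hp := hs.eq_prod_roots_of_monic hm
  obtain ⟨x, y, z, w, ht⟩ := Multiset.card_eq_four.mp hc
  refine ⟨![x, y, z, w], ?_, ?_⟩
  · rw [hp, ht, Fin.prod_univ_four]
    simp [mul_assoc]
  · rw [map_monicQuartic]; exact h

/-- The form with coefficients `a, …, e` over an arbitrary ring. -/
def quartic {R : Type*} [CommRing R] (a b c d e x y : R) : R :=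
  a * x ^ 4 + b * x ^ 3 * y + c * x ^ 2 * y ^ 2 + d * x * y ^ 3 + e * y ^ 4

/-- A quartic form in the coordinates of a new basis. -/
theorem exists_quartic_comp (a b c d e p₁ p₂ q₁ q₂ : ℤ) :
    ∃ B C D E : ℤ, ∀ {R : Type} [CommRing R] (x y : R),
      quartic (a : R) b c d e (x * p₁ + y * q₁) (x * p₂ + y * q₂) =
        quartic ((quarticFormVal a b c d e (p₁, p₂) : ℤ) : R) B C D E x y := by
  refine ⟨4 * a * p₁ ^ 3 * q₁ + b * (3 * p₁ ^ 2 * q₁ * p₂ + p₁ ^ 3 * q₂) +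
      c * (2 * p₁ * q₁ * p₂ ^ 2 + 2 * p₁ ^ 2 * p₂ * q₂) +
      d * (q₁ * p₂ ^ 3 + 3 * p₁ * p₂ ^ 2 * q₂) + 4 * e * p₂ ^ 3 * q₂,
    6 * a * p₁ ^ 2 * q₁ ^ 2 + b * (3 * p₁ * q₁ ^ 2 * p₂ + 3 * p₁ ^ 2 * q₁ * q₂) +
      c * (q₁ ^ 2 * p₂ ^ 2 + 4 * p₁ * q₁ * p₂ * q₂ + p₁ ^ 2 * q₂ ^ 2) +
      d * (3 * q₁ * p₂ ^ 2 * q₂ + 3 * p₁ * p₂ * q₂ ^ 2) + 6 * e * p₂ ^ 2 * q₂ ^ 2,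
    4 * a * p₁ * q₁ ^ 3 + b * (q₁ ^ 3 * p₂ + 3 * p₁ * q₁ ^ 2 * q₂) +
      c * (2 * q₁ ^ 2 * p₂ * q₂ + 2 * p₁ * q₁ * q₂ ^ 2) +
      d * (3 * q₁ * p₂ * q₂ ^ 2 + p₁ * q₂ ^ 3) + 4 * e * p₂ * q₂ ^ 3,
    quarticFormVal a b c d e (q₁, q₂), fun x y => ?_⟩
  simp only [quartic, quarticFormVal]; push_cast; ring

theorem irreducible_monicQuartic {F : MvPolynomial (Fin 2) ℚ} (hF : Irreducible F)
    {A b c d e p₁ p₂ q₁ q₂ : ℚ} (hdet : p₁ * q₂ - q₁ * p₂ = 1)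
    (h : F = MvPolynomial.C A * MvPolynomial.aeval
      ![MvPolynomial.C q₂ * MvPolynomial.X 0 - MvPolynomial.C q₁ * MvPolynomial.X 1,
        MvPolynomial.C p₁ * MvPolynomial.X 1 - MvPolynomial.C p₂ * MvPolynomial.X 0]
      ((monicQuartic b c d e).homogenize 4)) :
    Irreducible (monicQuartic b c d e) := by
  set φ : MvPolynomial (Fin 2) ℚ →ₐ[ℚ] MvPolynomial (Fin 2) ℚ := MvPolynomial.aeval
      ![MvPolynomial.C q₂ * MvPolynomial.X 0 - MvPolynomial.C q₁ * MvPolynomial.X 1,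
        MvPolynomial.C p₁ * MvPolynomial.X 1 - MvPolynomial.C p₂ * MvPolynomial.X 0] with hφ
  set ψ : MvPolynomial (Fin 2) ℚ →ₐ[ℚ] ℚ[X] := MvPolynomial.aeval
      ![C p₁ * X + C q₁, C p₂ * X + C q₂] with hψ
  have hdet' : (C p₁ * C q₂ - C q₁ * C p₂ : ℚ[X]) = 1 := by
    rw [← C_mul, ← C_mul, ← C_sub, hdet, C_1]
  have hC (r : ℚ) : ψ (MvPolynomial.C r) = C r := by
    rw [hψ, MvPolynomial.aeval_C]; rfl
  have hcomp : ψ.comp φ = MvPolynomial.aeval ![X, 1] := by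
    refine MvPolynomial.algHom_ext fun i => ?_
    fin_cases i
    · simp only [AlgHom.comp_apply, hφ, MvPolynomial.aeval_X]
      simp [hψ]
      linear_combination (X : ℚ[X]) * hdet'
    · simp only [AlgHom.comp_apply, hφ, MvPolynomial.aeval_X]
      simp [hψ]
      linear_combination hdet'
  have hunit (g : ℚ[X]) (hg : IsUnit (φ (g.homogenize g.natDegree))) : g.natDegree = 0 := by
    have h1 := hg.map ψ
    rw [← AlgHom.comp_apply, hcomp, aeval_homogenize_X_one g le_rfl] at h1
    exact natDegree_eq_zero_of_isUnit h1
  rw [(monic_monicQuartic b c d e).irreducible_iff_natDegree]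
  refine ⟨fun h1 => ?_, fun g k hg hk hgk => ?_⟩
  · have := natDegree_monicQuartic b c d e
    rw [h1, natDegree_one] at this
    norm_num at this
  · have hd : g.natDegree + k.natDegree = 4 := by
      rw [← hg.natDegree_mul hk, hgk, natDegree_monicQuartic]
    rw [← hd, ← hgk, homogenize_mul g k le_rfl le_rfl, map_mul, ← mul_assoc] at h
    rcases hF.isUnit_or_isUnit h with h1 | h1
    · exact Or.inl (hunit g (isUnit_of_mul_isUnit_right h1))
    · exact Or.inr (hunit k h1)

theorem homogenize_monicQuartic (b c d e : ℚ) : (monicQuartic b c d e).homogenize 4 =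
    quartic 1 (MvPolynomial.C b) (MvPolynomial.C c) (MvPolynomial.C d) (MvPolynomial.C e)
      (MvPolynomial.X 0) (MvPolynomial.X 1) := by
  simp only [monicQuartic, homogenize_add, homogenize_C_mul, homogenize_C]
  rw [homogenize_X_pow le_rfl, homogenize_X_pow (by norm_num), homogenize_X_pow (by norm_num),
    homogenize_X (by norm_num), quartic]
  ring

theorem isCoprime_of_quarticFormVal {a b c d e : ℤ} {p : ℤ × ℤ}
    (hp : quarticFormVal a b c d e p = 1 ∨ quarticFormVal a b c d e p = -1) :
    IsCoprime p.1 p.2 := by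
  have h1 : quarticFormVal a b c d e p = p.1 * (a * p.1 ^ 3 + b * p.1 ^ 2 * p.2 +
      c * p.1 * p.2 ^ 2 + d * p.2 ^ 3) + p.2 * (e * p.2 ^ 3) := by
    rw [quarticFormVal]; ring
  set r := a * p.1 ^ 3 + b * p.1 ^ 2 * p.2 + c * p.1 * p.2 ^ 2 + d * p.2 ^ 3
  set s := e * p.2 ^ 3
  rcases hp with hp | hp
  · exact ⟨r, s, by linarith⟩
  · exact ⟨-r, -s, by linarith⟩

theorem card_le_of_irreducible (a b c d e : ℤ)
    (hirr : Irreducible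
      (MvPolynomial.C (a : ℚ) * MvPolynomial.X 0 ^ 4 +
        MvPolynomial.C (b : ℚ) * MvPolynomial.X 0 ^ 3 * MvPolynomial.X 1 +
        MvPolynomial.C (c : ℚ) * MvPolynomial.X 0 ^ 2 * MvPolynomial.X 1 ^ 2 +
        MvPolynomial.C (d : ℚ) * MvPolynomial.X 0 * MvPolynomial.X 1 ^ 3 +
        MvPolynomial.C (e : ℚ) * MvPolynomial.X 1 ^ 4 : MvPolynomial (Fin 2) ℚ))
    (T : Finset (ℤ × ℤ))
    (hT : ∀ p ∈ T, quarticFormVal a b c d e p = 1 ∨ quarticFormVal a b c d e p = -1)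
    (hneg : ∀ p ∈ T, -p ∉ T) : T.card ≤ 276 := by
  classical
  rcases T.eq_empty_or_nonempty with rfl | ⟨p, hp⟩
  · simp
  obtain ⟨q, hpq⟩ := exists_det_eq_one (isCoprime_of_quarticFormVal (hT p hp))
  obtain ⟨B, G, D, E, hF⟩ := exists_quartic_comp a b c d e p.1 p.2 q.1 q.2
  set A := quarticFormVal a b c d e p with hA
  have hAA : A * A = 1 := by rcases hT p hp with h | h <;> rw [hA, h] <;> norm_num
  have hAQ : (A * A : ℚ) = 1 := by exact_mod_cast hAA
  have hdet : (p.1 * q.2 - q.1 * p.2 : ℚ) = 1 := by exact_mod_cast hpq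
  have hirr' : Irreducible (monicQuartic ((A * B : ℤ) : ℚ) ((A * G : ℤ) : ℚ) ((A * D : ℤ) : ℚ)
      ((A * E : ℤ) : ℚ)) := by
    refine irreducible_monicQuartic hirr hdet (A := A) ?_
    rw [homogenize_monicQuartic]
    have h1 := hF (MvPolynomial.C (q.2 : ℚ) * MvPolynomial.X 0 -
      MvPolynomial.C (q.1 : ℚ) * MvPolynomial.X 1 : MvPolynomial (Fin 2) ℚ)
      (MvPolynomial.C (p.1 : ℚ) * MvPolynomial.X 1 - MvPolynomial.C (p.2 : ℚ) * MvPolynomial.X 0)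
    have hdetC : (MvPolynomial.C (p.1 : ℚ) * MvPolynomial.C (q.2 : ℚ) -
        MvPolynomial.C (q.1 : ℚ) * MvPolynomial.C (p.2 : ℚ) : MvPolynomial (Fin 2) ℚ) = 1 := by
      rw [← MvPolynomial.C_mul, ← MvPolynomial.C_mul, ← MvPolynomial.C_sub, hdet, MvPolynomial.C_1]
    have hAC : (MvPolynomial.C (A : ℚ) * MvPolynomial.C (A : ℚ) : MvPolynomial (Fin 2) ℚ) = 1 := by
      rw [← MvPolynomial.C_mul, hAQ, MvPolynomial.C_1]
    have hz (k : ℤ) : (k : MvPolynomial (Fin 2) ℚ) = MvPolynomial.C (k : ℚ) :=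
      (map_intCast (MvPolynomial.C (σ := Fin 2) (R := ℚ)) k).symm
    simp only [hz] at h1
    set x : MvPolynomial (Fin 2) ℚ := MvPolynomial.C (q.2 : ℚ) * MvPolynomial.X 0 -
      MvPolynomial.C (q.1 : ℚ) * MvPolynomial.X 1 with hx
    set y : MvPolynomial (Fin 2) ℚ := MvPolynomial.C (p.1 : ℚ) * MvPolynomial.X 1 -
      MvPolynomial.C (p.2 : ℚ) * MvPolynomial.X 0 with hy
    have h2 : x * MvPolynomial.C (p.1 : ℚ) + y * MvPolynomial.C (q.1 : ℚ) = MvPolynomial.X 0 := by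
      rw [hx, hy]; linear_combination MvPolynomial.X 0 * hdetC
    have h3 : x * MvPolynomial.C (p.2 : ℚ) + y * MvPolynomial.C (q.2 : ℚ) = MvPolynomial.X 1 := by
      rw [hx, hy]; linear_combination MvPolynomial.X 1 * hdetC
    rw [h2, h3] at h1
    simp only [quartic, map_add, map_mul, map_pow, map_one, MvPolynomial.aeval_X, Int.cast_mul,
      MvPolynomial.aeval_C, MvPolynomial.algebraMap_eq, Matrix.cons_val_zero, Matrix.cons_val_one] at h1 ⊢
    linear_combination h1 - (MvPolynomial.C (B : ℚ) * x ^ 3 * y +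
      MvPolynomial.C (G : ℚ) * x ^ 2 * y ^ 2 + MvPolynomial.C (D : ℚ) * x * y ^ 3 +
      MvPolynomial.C (E : ℚ) * y ^ 4) * hAC
  obtain ⟨γ, hγ⟩ := exists_isRootSystem hirr'
  set f := monicQuartic (A * B) (A * G) (A * D) (A * E) with hf
  set κ : ℤ × ℤ → ℤ × ℤ := fun r => (det r q, det p r) with hκ
  have hcomb (r : ℤ × ℤ) : comb p q (κ r) = r := comb_coords hpq r
  have hinj : Function.Injective κ := fun r s hrs => by
    rw [← hcomb r, hrs, hcomb]
  have hval (v : ℤ × ℤ) : formVal f v = A * quarticFormVal a b c d e (comb p q v) := by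
    have h1 := hF v.1 v.2
    simp only [Int.cast_id, quartic] at h1
    simp only [quarticFormVal, comb]
    rw [h1, hf, formVal_monicQuartic]
    linear_combination -v.1 ^ 4 * hAA
  rw [← Finset.card_image_of_injective T hinj]
  refine hγ.card_le _ (fun v hv => ?_) fun v hv hv' => ?_
  · obtain ⟨r, hr, rfl⟩ := Finset.mem_image.mp hv
    rw [IsSol, hval, hcomb]
    rcases hT p hp with h | h <;> rcases hT r hr with h' | h' <;> rw [hA, h, h'] <;> norm_num
  · obtain ⟨r, hr, rfl⟩ := Finset.mem_image.mp hv
    obtain ⟨s, hs, hsr⟩ := Finset.mem_image.mp hv'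
    have h1 : s = -r := by rw [← hcomb s, hsr, comb_neg, hcomb]
    exact hneg r hr (h1 ▸ hs)

end QuarticThue

/-- A quartic Thue equation `F(U,V) = ±1`, with `F` irreducible over `ℚ`, has at most
`276` integer solutions (counting `(u,v)` and `(-u,-v)` as one solution). -/
theorem quartic_thue_eq_at_most_276_solutions (a b c d e : ℤ)
    (hirr : Irreducible
      (MvPolynomial.C (a : ℚ) * MvPolynomial.X 0 ^ 4 +
        MvPolynomial.C (b : ℚ) * MvPolynomial.X 0 ^ 3 * MvPolynomial.X 1 +
        MvPolynomial.C (c : ℚ) * MvPolynomial.X 0 ^ 2 * MvPolynomial.X 1 ^ 2 +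
        MvPolynomial.C (d : ℚ) * MvPolynomial.X 0 * MvPolynomial.X 1 ^ 3 +
        MvPolynomial.C (e : ℚ) * MvPolynomial.X 1 ^ 4 : MvPolynomial (Fin 2) ℚ)) :
    Finite (Quot (pmRelQuartic a b c d e)) ∧
      Nat.card (Quot (pmRelQuartic a b c d e)) ≤ 276 := by
  classical
  have key (s : Finset (Quot (pmRelQuartic a b c d e))) : s.card ≤ 276 := by
    set r : Quot (pmRelQuartic a b c d e) → ℤ × ℤ := fun x => (Quot.out x).1 with hr
    have hrel (x y : Quot (pmRelQuartic a b c d e)) (h : r x = r y ∨ r x = -r y) : x = y := by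
      rw [← Quot.out_eq x, ← Quot.out_eq y]
      exact Quot.sound h
    have hinj : Function.Injective r := fun x y hxy => hrel x y (Or.inl hxy)
    rw [← Finset.card_image_of_injective s hinj]
    refine QuarticThue.card_le_of_irreducible a b c d e hirr _ (fun p hp => ?_) fun p hp hp' => ?_
    · obtain ⟨x, -, rfl⟩ := Finset.mem_image.mp hp
      exact (Quot.out x).2
    · obtain ⟨x, -, rfl⟩ := Finset.mem_image.mp hp
      obtain ⟨y, -, hy⟩ := Finset.mem_image.mp hp'
      have hxy : y = x := hrel y x (Or.inr hy)
      rw [hxy] at hy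
      have h1 : (r x).1 = 0 := by
        have := congrArg Prod.fst hy
        rw [Prod.fst_neg] at this; omega
      have h2 : (r x).2 = 0 := by
        have := congrArg Prod.snd hy
        rw [Prod.snd_neg] at this; omega
      have h3 := QuarticThue.isCoprime_of_quarticFormVal (Quot.out x).2
      change IsCoprime (r x).1 (r x).2 at h3
      rw [h1, h2] at h3
      exact not_isCoprime_zero_zero h3
  have hfin : Finite (Quot (pmRelQuartic a b c d e)) := by
    by_contra h
    rw [not_finite_iff_infinite] at h
    obtain ⟨s, hs⟩ := Infinite.exists_subset_card_eq (Quot (pmRelQuartic a b c d e)) 277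
    have := key s
    omega
  refine ⟨hfin, ?_⟩
  have := Fintype.ofFinite (Quot (pmRelQuartic a b c d e))
  rw [Nat.card_eq_fintype_card]
  exact key Finset.univ
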